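/- arXiv:2003.07035 — 2 statements merged into one kernel-verified Lean document; each statement's English description precedes it below -/
import Mathlib

section
/- Let (R, I) be a graded pair with gcd{m > 0 : R_m ≠ 0} = 1, and let 0 → N → N' → Q'' → 0 be an exact sequence of finitely generated graded R-modules in which the maps are graded R-linear of degree 0 and the dimension of the support of Q'' is strictly less than d = dim R. Then the sequence {f_n(N_R,I)}_n converges uniformly on [0,∞) if and only if {f_n(N'_R,I)}_n does, and in that case lim_{n→∞} f_n(N_R,I) = lim_{n→∞} f_n(N'_R,I). -/
open Filter MeasureTheory Topology

noncomputable section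

/-- The `q`-th Frobenius bracket power `I^{[q]}` of an ideal `I`. -/
def Ideal.frobeniusPow {R : Type*} [CommSemiring R] (I : Ideal R) (q : ℕ) : Ideal R :=
  Ideal.span ((· ^ q) '' (I : Set R))

/-- `dim_k` of the degree-`j` graded piece of `M ⧸ N`, for a graded `k`-module `M`
with grading `ℳ` and a `k`-submodule `N ≤ M`. -/
def gradedPieceLen (k : Type*) [Field k] {M : Type*} [AddCommGroup M] [Module k M]
    (ℳ : ℕ → Submodule k M) (N : Submodule k M) (j : ℕ) : ℕ :=
  Module.finrank k (↥(ℳ j) ⧸ (N.comap (ℳ j).subtype))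

/-- The step function `f_n(M_R, I)` of a graded pair, for a graded module `M`. -/
def hkStep (k : Type*) [Field k] {R M : Type*} [CommRing R] [AddCommGroup M] [Module R M]
    [Module k M] [SMul k R] [IsScalarTower k R M]
    (ℳ : ℕ → Submodule k M) (I : Ideal R) (d n₀ p n : ℕ) (x : ℝ) : ℝ :=
  (∑ i ∈ Finset.range n₀,
      (gradedPieceLen k ℳ ((I.frobeniusPow (p ^ n) • (⊤ : Submodule R M)).restrictScalars k)
        (⌊x * (p ^ n : ℕ)⌋₊ * n₀ + i) : ℝ)) / ((p : ℝ) ^ n) ^ (d - 1)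

/-- The interpolated function `g_n(M_R, I)` of a graded pair. -/
def hkStepG (k : Type*) [Field k] {R M : Type*} [CommRing R] [AddCommGroup M] [Module R M]
    [Module k M] [SMul k R] [IsScalarTower k R M]
    (ℳ : ℕ → Submodule k M) (I : Ideal R) (d n₀ p n : ℕ) (x : ℝ) : ℝ :=
  (1 - (x * (p ^ n : ℕ) - ⌊x * (p ^ n : ℕ)⌋₊)) *
      hkStep k ℳ I d n₀ p n ((⌊x * (p ^ n : ℕ)⌋₊ : ℝ) / (p ^ n : ℕ))
    + (x * (p ^ n : ℕ) - ⌊x * (p ^ n : ℕ)⌋₊) *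
      hkStep k ℳ I d n₀ p n ((⌊x * (p ^ n : ℕ)⌋₊ + 1 : ℝ) / (p ^ n : ℕ))

section GradedComponents

variable {k : Type*} [Field k]

/-- The degree `j` component of an element of a graded `k`-module, as a linear map. -/
def gradedProj {M : Type*} [AddCommGroup M] [Module k M] (ℳ : ℕ → Submodule k M)
    [DirectSum.Decomposition ℳ] (j : ℕ) : M →ₗ[k] M :=
  (ℳ j).subtype ∘ₗ DirectSum.component k ℕ (fun i => ℳ i) j ∘ₗ
    (DirectSum.decomposeLinearEquiv ℳ).toLinearMap

section Module

variable {M : Type*} [AddCommGroup M] [Module k M] (ℳ : ℕ → Submodule k M)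
  [DirectSum.Decomposition ℳ]

lemma gradedProj_apply (j : ℕ) (x : M) :
    gradedProj ℳ j x = (DirectSum.decompose ℳ x j : M) := rfl

lemma gradedProj_mem (j : ℕ) (x : M) : gradedProj ℳ j x ∈ ℳ j :=
  (DirectSum.decompose ℳ x j).2

lemma gradedProj_of_mem {j : ℕ} {x : M} (hx : x ∈ ℳ j) : gradedProj ℳ j x = x :=
  DirectSum.decompose_of_mem_same ℳ hx

lemma gradedProj_of_mem_ne {i j : ℕ} {x : M} (hx : x ∈ ℳ i) (hij : i ≠ j) :
    gradedProj ℳ j x = 0 :=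
  DirectSum.decompose_of_mem_ne ℳ hx hij

/-- The graded pieces of the shift `M(-i)`, as submodules of `M`. -/
def shiftedPiece (i m : ℕ) : Submodule k M := if i ≤ m then ℳ (m - i) else ⊥

lemma ite_gradedProj_mem_shiftedPiece (i m : ℕ) (x : M) :
    (if i ≤ m then gradedProj ℳ (m - i) x else 0) ∈ shiftedPiece ℳ i m := by
  unfold shiftedPiece
  split_ifs
  · exact gradedProj_mem ℳ _ x
  · exact Submodule.zero_mem _

lemma exists_gradedProj_eq_zero (x : M) : ∃ t, ∀ m, t ≤ m → gradedProj ℳ m x = 0 := by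
  classical
  refine ⟨(DirectSum.decompose ℳ x).support.sup id + 1, fun m hm => ?_⟩
  rw [gradedProj_apply]
  have : m ∉ (DirectSum.decompose ℳ x).support := fun h => by
    have := Finset.le_sup (f := id) h
    simp at this
    omega
  simpa using this

/-- A map of graded modules of degree `0` commutes with taking components. -/
lemma map_gradedProj {M' : Type*} [AddCommGroup M'] [Module k M'] (ℳ' : ℕ → Submodule k M')
    [DirectSum.Decomposition ℳ'] (f : M →+ M') (hf : ∀ j, ∀ x ∈ ℳ j, f x ∈ ℳ' j)
    (j : ℕ) (x : M) : f (gradedProj ℳ j x) = gradedProj ℳ' j (f x) := by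
  induction x using DirectSum.Decomposition.inductionOn ℳ with
  | zero => simp
  | @homogeneous i y =>
    by_cases h : i = j
    · subst h
      rw [gradedProj_of_mem ℳ y.2, gradedProj_of_mem ℳ' (hf _ _ y.2)]
    · rw [gradedProj_of_mem_ne ℳ y.2 h, gradedProj_of_mem_ne ℳ' (hf _ _ y.2) h, map_zero]
  | add a b ha hb => simp [ha, hb]

end Module

variable {R : Type*} [CommRing R] [Algebra k R] (𝒜 : ℕ → Submodule k R) [GradedAlgebra 𝒜]
  {M : Type*} [AddCommGroup M] [Module R M] [Module k M] [IsScalarTower k R M]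
  (ℳ : ℕ → Submodule k M) [DirectSum.Decomposition ℳ] [SetLike.GradedSMul 𝒜 ℳ]

omit [GradedAlgebra 𝒜] [IsScalarTower k R M] in
lemma gradedProj_smul_of_mem_left {i : ℕ} {a : R} (ha : a ∈ 𝒜 i) (x : M) (m : ℕ) :
    gradedProj ℳ m (a • x) = a • (if i ≤ m then gradedProj ℳ (m - i) x else 0) := by
  induction x using DirectSum.Decomposition.inductionOn ℳ with
  | zero => simp
  | @homogeneous j y =>
    have hy : a • (y : M) ∈ ℳ (i + j) := SetLike.GradedSMul.smul_mem ha y.2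
    by_cases h : i + j = m
    · subst h
      rw [gradedProj_of_mem ℳ hy, if_pos (by omega), gradedProj_of_mem ℳ]
      simp
    · rw [gradedProj_of_mem_ne ℳ hy h]
      split_ifs with h1
      · rw [gradedProj_of_mem_ne ℳ y.2 (by omega), smul_zero]
      · simp
  | add b c hb hc =>
    rw [smul_add, map_add, hb, hc, ← smul_add]
    congr 1
    split_ifs <;> simp

omit [IsScalarTower k R M] in
lemma gradedProj_smul_of_mem_right {i : ℕ} (a : R) {x : M} (hx : x ∈ ℳ i) (m : ℕ) :
    gradedProj ℳ m (a • x) = (if i ≤ m then gradedProj 𝒜 (m - i) a else 0) • x := by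
  induction a using DirectSum.Decomposition.inductionOn 𝒜 with
  | zero => simp
  | @homogeneous j y =>
    have hy : (y : R) • x ∈ ℳ (j + i) := SetLike.GradedSMul.smul_mem y.2 hx
    by_cases h : j + i = m
    · subst h
      rw [gradedProj_of_mem ℳ hy, if_pos (by omega), gradedProj_of_mem 𝒜]
      simp
    · rw [gradedProj_of_mem_ne ℳ hy h]
      split_ifs with h1
      · rw [gradedProj_of_mem_ne 𝒜 y.2 (by omega), zero_smul]
      · simp
  | add b c hb hc =>
    rw [add_smul, map_add, hb, hc, ← add_smul]
    congr 1
    split_ifs <;> simp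

omit [IsScalarTower k R M] in
/-- A graded ideal or module generated by homogeneous elements: the degree `m` piece is spanned
by the generators with coefficients of the complementary degrees. -/
lemma gradedPiece_le_of_span_eq_top {T : Finset M} {deg : M → ℕ}
    (hdeg : ∀ x ∈ T, x ∈ ℳ (deg x)) (m : ℕ) {z : M} (hz : z ∈ ℳ m)
    (hzT : z ∈ Submodule.span R (T : Set M)) :
    ∃ c : M → R, (∀ x ∈ T, c x ∈ shiftedPiece 𝒜 (deg x) m) ∧ z = ∑ x ∈ T, c x • x := by
  obtain ⟨f, -, hf⟩ := Submodule.mem_span_finset.1 hzT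
  refine ⟨fun x => if deg x ≤ m then gradedProj 𝒜 (m - deg x) (f x) else 0,
    fun x _ => ite_gradedProj_mem_shiftedPiece 𝒜 _ _ _, ?_⟩
  rw [← gradedProj_of_mem ℳ hz, ← hf, map_sum]
  exact Finset.sum_congr rfl fun x hx => gradedProj_smul_of_mem_right 𝒜 ℳ _ (hdeg x hx) m

omit [GradedAlgebra 𝒜] [IsScalarTower k R M] in
/-- If `J` is generated by homogeneous elements, the degree `m` piece of `J M` is spanned by the
products of the generators with elements of the complementary degrees. -/
lemma exists_eq_sum_of_mem_span_smul_top {ι : Type*} {T : Finset ι} {g : ι → R} {deg : ι → ℕ}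
    (hdeg : ∀ x ∈ T, g x ∈ 𝒜 (deg x)) (m : ℕ) {z : M} (hz : z ∈ ℳ m)
    (hzT : z ∈ Ideal.span (g '' (T : Set ι)) • (⊤ : Submodule R M)) :
    ∃ y : ι → M, (∀ x ∈ T, y x ∈ shiftedPiece ℳ (deg x) m) ∧ z = ∑ x ∈ T, g x • y x := by
  have key : ∀ w ∈ Ideal.span (g '' (T : Set ι)) • (⊤ : Submodule R M),
      ∃ y : ι → M, w = ∑ x ∈ T, g x • y x := by
    classical
    intro w hw
    refine Submodule.smul_induction_on hw ?_ ?_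
    · intro r hr n _
      obtain ⟨f, hf⟩ := (Submodule.mem_span_image_finset_iff_exists_fun R).1 hr
      refine ⟨fun x => if h : x ∈ T then f ⟨x, h⟩ • n else 0, ?_⟩
      rw [← hf, Finset.sum_smul, ← Finset.sum_coe_sort T]
      refine Finset.sum_congr rfl fun x _ => ?_
      beta_reduce
      rw [dif_pos x.2, smul_eq_mul, mul_comm, mul_smul]
    · rintro _ _ ⟨y, rfl⟩ ⟨y', rfl⟩
      exact ⟨y + y', by simp [smul_add, Finset.sum_add_distrib]⟩
  obtain ⟨y, hy⟩ := key z hzT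
  refine ⟨fun x => if deg x ≤ m then gradedProj ℳ (m - deg x) (y x) else 0,
    fun x _ => ite_gradedProj_mem_shiftedPiece ℳ _ _ _, ?_⟩
  rw [← gradedProj_of_mem ℳ hz, hy, map_sum]
  exact Finset.sum_congr rfl fun x hx => gradedProj_smul_of_mem_left 𝒜 ℳ (hdeg x hx) _ m

omit [Algebra k R] [IsScalarTower k R M] in
/-- A finitely generated graded submodule has a finite set of homogeneous generators. -/
lemma exists_homogeneous_generators (P : Submodule R M) (hP : P.FG)
    (hhom : ∀ x ∈ P, ∀ j, gradedProj ℳ j x ∈ P) :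
    ∃ (T : Finset M) (deg : M → ℕ), (∀ x ∈ T, x ∈ ℳ (deg x)) ∧
      Submodule.span R (T : Set M) = P := by
  classical
  obtain ⟨S, hS⟩ := hP
  let T : Finset M := S.biUnion fun x =>
    (DirectSum.decompose ℳ x).support.image fun j => gradedProj ℳ j x
  have hT : ∀ x ∈ T, ∃ j, x ∈ ℳ j := by
    intro x hx
    simp only [T, Finset.mem_biUnion, Finset.mem_image] at hx
    obtain ⟨a, -, j, -, rfl⟩ := hx
    exact ⟨j, gradedProj_mem ℳ j a⟩
  choose! deg hdeg using hT
  refine ⟨T, deg, hdeg, le_antisymm (Submodule.span_le.2 ?_) ?_⟩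
  · intro x hx
    simp only [T, Finset.mem_coe, Finset.mem_biUnion, Finset.mem_image] at hx
    obtain ⟨a, ha, j, -, rfl⟩ := hx
    exact hhom a (hS ▸ Submodule.subset_span ha) j
  · rw [← hS]
    refine Submodule.span_le.2 fun x hx => ?_
    have hsum := DirectSum.sum_support_decompose ℳ x
    rw [← hsum]
    refine Submodule.sum_mem _ fun j hj => Submodule.subset_span ?_
    simp only [T, Finset.mem_coe, Finset.mem_biUnion, Finset.mem_image]
    exact ⟨x, hx, j, hj, rfl⟩

end GradedComponents

section SpannedModulo

variable {k : Type*} [Field k]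

/-- `W` is spanned by at most `c` elements modulo `J`. -/
def SpannedModulo {M : Type*} [AddCommGroup M] [Module k M] (W J : Submodule k M) (c : ℕ) :
    Prop :=
  ∃ s : Finset M, s.card ≤ c ∧ W ≤ Submodule.span k (s : Set M) ⊔ J

namespace SpannedModulo

variable {M : Type*} [AddCommGroup M] [Module k M] {W W' J : Submodule k M} {c c' : ℕ}

lemma mono (h : SpannedModulo W J c) (hc : c ≤ c') : SpannedModulo W J c' := by
  obtain ⟨s, hs, hW⟩ := h
  exact ⟨s, hs.trans hc, hW⟩

lemma of_le (h : W ≤ J) : SpannedModulo W J 0 :=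
  ⟨∅, by simp, h.trans le_sup_right⟩

lemma mono_left (h : SpannedModulo W' J c) (hW : W ≤ W') : SpannedModulo W J c := by
  obtain ⟨s, hs, hW'⟩ := h
  exact ⟨s, hs, hW.trans hW'⟩

lemma mono_right {J' : Submodule k M} (h : SpannedModulo W J c) (hJ : J ≤ J') :
    SpannedModulo W J' c := by
  obtain ⟨s, hs, hW'⟩ := h
  exact ⟨s, hs, hW'.trans (sup_le_sup_left hJ _)⟩

lemma sup (h : SpannedModulo W J c) (h' : SpannedModulo W' J c') :
    SpannedModulo (W ⊔ W') J (c + c') := by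
  classical
  obtain ⟨s, hs, hW⟩ := h
  obtain ⟨s', hs', hW'⟩ := h'
  refine ⟨s ∪ s', (Finset.card_union_le _ _).trans (add_le_add hs hs'), ?_⟩
  rw [Finset.coe_union, Submodule.span_union]
  exact sup_le (hW.trans (sup_le_sup_right le_sup_left _))
    (hW'.trans (sup_le_sup_right le_sup_right _))

lemma finset_sup {ι : Type*} (T : Finset ι) {W : ι → Submodule k M} {c : ι → ℕ}
    (h : ∀ i ∈ T, SpannedModulo (W i) J (c i)) :
    SpannedModulo (T.sup W) J (∑ i ∈ T, c i) := by
  classical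
  induction T using Finset.induction_on with
  | empty => exact of_le (by simp)
  | insert a T ha ih =>
    rw [Finset.sup_insert, Finset.sum_insert ha]
    exact (h a (by simp)).sup (ih fun i hi => h i (by simp [hi]))

lemma map {M' : Type*} [AddCommGroup M'] [Module k M'] (f : M →ₗ[k] M')
    (h : SpannedModulo W J c) : SpannedModulo (W.map f) (J.map f) c := by
  classical
  obtain ⟨s, hs, hW⟩ := h
  refine ⟨s.image f, Finset.card_image_le.trans hs, ?_⟩
  rw [Finset.coe_image, Submodule.span_image, ← Submodule.map_sup]
  exact Submodule.map_mono hW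

lemma finite (h : SpannedModulo W ⊥ c) : FiniteDimensional k W := by
  obtain ⟨s, hs, hW⟩ := h
  rw [sup_bot_eq] at hW
  exact Submodule.finiteDimensional_of_le hW

lemma finrank_le (h : SpannedModulo W ⊥ c) : Module.finrank k W ≤ c := by
  obtain ⟨s, hs, hW⟩ := h
  rw [sup_bot_eq] at hW
  exact (Submodule.finrank_mono hW).trans ((finrank_span_finset_le_card s).trans hs)

lemma finrank_le_add [FiniteDimensional k J] (h : SpannedModulo W J c) :
    Module.finrank k W ≤ Module.finrank k J + c := by
  obtain ⟨s, hs, hW⟩ := h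
  calc Module.finrank k W ≤ Module.finrank k ↥(Submodule.span k (s : Set M) ⊔ J) :=
        Submodule.finrank_mono hW
    _ ≤ Module.finrank k (Submodule.span k (s : Set M)) + Module.finrank k J :=
        Submodule.finrank_add_le_finrank_add_finrank _ _
    _ ≤ c + Module.finrank k J :=
        Nat.add_le_add_right ((finrank_span_finset_le_card s).trans hs) _
    _ = Module.finrank k J + c := Nat.add_comm _ _

/-- If `W` surjects onto `W''` with kernel contained in `J`, then `W` is spanned modulo `J` by
`dim W''` elements. -/
lemma of_linearMap {M'' : Type*} [AddCommGroup M''] [Module k M''] (f : M →ₗ[k] M'')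
    (W'' : Submodule k M'') [FiniteDimensional k W''] (hsurj : W'' ≤ W.map f)
    (hmap : ∀ x ∈ W, f x ∈ W'') (hker : ∀ x ∈ W, f x = 0 → x ∈ J) :
    SpannedModulo W J (Module.finrank k W'') := by
  classical
  let b := Module.finBasis k W''
  have hl : ∀ i, ∃ x ∈ W, f x = b i := fun i => hsurj (b i).2
  choose g hgW hg using hl
  refine ⟨Finset.univ.image g, Finset.card_image_le.trans (by simp), ?_⟩
  · intro x hx
    let y := ∑ i, b.repr ⟨f x, hmap x hx⟩ i • g i
    have hyW : y ∈ W := Submodule.sum_mem _ fun i _ => Submodule.smul_mem _ _ (hgW i)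
    have hfy : f y = f x := by
      have h := congrArg Subtype.val (b.sum_repr ⟨f x, hmap x hx⟩)
      rw [Submodule.coe_sum] at h
      simp only [y, map_sum, map_smul, hg]
      exact h
    have hy : y ∈ Submodule.span k ((Finset.univ.image g : Finset M) : Set M) :=
      Submodule.sum_mem _ fun i _ => Submodule.smul_mem _ _ (Submodule.subset_span (by simp))
    have hxy : x - y ∈ J := hker _ (W.sub_mem hx hyW) (by simp [hfy])
    exact Submodule.mem_sup.2 ⟨y, hy, x - y, hxy, by abel⟩

end SpannedModulo

end SpannedModulo

section HilbertFunction

variable {k : Type*} [Field k] {R : Type*} [CommRing R] [Algebra k R]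
  (𝒜 : ℕ → Submodule k R)

lemma spannedModulo_of_finite_quotient (K : Ideal R) [Module.Finite k (R ⧸ K)]
    (W : Submodule k R) :
    SpannedModulo W (K.restrictScalars k) (Module.finrank k (R ⧸ K)) := by
  have h := SpannedModulo.of_linearMap (W := ⊤) (J := K.restrictScalars k)
    (Ideal.Quotient.mkₐ k K).toLinearMap ⊤
    (by
      rw [Submodule.map_top, LinearMap.range_eq_top.2]
      exact Ideal.Quotient.mkₐ_surjective k K)
    (by simp) (fun x _ hx => by simpa [Ideal.Quotient.eq_zero_iff_mem] using hx)
  rw [finrank_top] at h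
  exact h.mono_left le_top

variable [GradedAlgebra 𝒜]

variable {𝒜} in
lemma Ideal.IsHomogeneous.gradedProj_mem {J : Ideal R} (hJ : J.IsHomogeneous 𝒜) {x : R}
    (hx : x ∈ J) (m : ℕ) : gradedProj 𝒜 m x ∈ J := hJ m hx

lemma exists_gradedPiece_le_of_finite_quotient (K : Ideal R) (hK : K.IsHomogeneous 𝒜)
    [Module.Finite k (R ⧸ K)] : ∃ t, ∀ m, t ≤ m → 𝒜 m ≤ K.restrictScalars k := by
  obtain ⟨s, -, hs⟩ := spannedModulo_of_finite_quotient K (⊤ : Submodule k R)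
  choose t ht using exists_gradedProj_eq_zero 𝒜
  refine ⟨s.sup t, fun m hm r hr => ?_⟩
  obtain ⟨v, hv, j, hj, hvj⟩ := Submodule.mem_sup.1 (hs (Submodule.mem_top (x := r)))
  have hv0 : gradedProj 𝒜 m v = 0 := by
    have : Submodule.span k (s : Set R) ≤ LinearMap.ker (gradedProj 𝒜 m) :=
      Submodule.span_le.2 fun x hx => ht x m ((Finset.le_sup (f := t) hx).trans hm)
    exact this hv
  rw [← gradedProj_of_mem 𝒜 hr, ← hvj, map_add, hv0, zero_add]
  exact hK.gradedProj_mem hj m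

/-- The exact sequence `R/K(-δ) → R/J → R/(J + aR) → 0`, for `a` homogeneous of degree `δ` with
`a K ⊆ J`. -/
lemma spannedModulo_gradedPiece_add {J K : Ideal R} (hJ : J.IsHomogeneous 𝒜) {δ : ℕ} {a : R}
    (ha : a ∈ 𝒜 δ) (haK : ∀ x ∈ K, a * x ∈ J) {m c c' : ℕ}
    (h : SpannedModulo (𝒜 m) ((J ⊔ Ideal.span {a}).restrictScalars k) c)
    (h' : δ ≤ m → SpannedModulo (𝒜 (m - δ)) (K.restrictScalars k) c') :
    SpannedModulo (𝒜 m) (J.restrictScalars k) (c + c') := by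
  classical
  obtain ⟨s, hs, hle⟩ := h
  have h1 : SpannedModulo ((Submodule.span k (s : Set R)).map (gradedProj 𝒜 m))
      (J.restrictScalars k) c := by
    refine (SpannedModulo.map (J := ⊥) (gradedProj 𝒜 m) ⟨s, hs, le_sup_left⟩).mono_right ?_
    simp
  have h2 : SpannedModulo ((shiftedPiece 𝒜 δ m).map (LinearMap.mulLeft k a))
      (J.restrictScalars k) c' := by
    unfold shiftedPiece
    split_ifs with hδ
    · refine ((h' hδ).map (LinearMap.mulLeft k a)).mono_right ?_
      rintro _ ⟨x, hx, rfl⟩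
      exact haK x hx
    · exact (SpannedModulo.of_le (by simp)).mono (Nat.zero_le _)
  obtain ⟨s', hs', hle'⟩ := h1.sup h2
  refine ⟨s', hs', ?_⟩
  intro r hr
  obtain ⟨v, hv, w, hw, hvw⟩ := Submodule.mem_sup.1 (hle hr)
  obtain ⟨j, hj, b, hb, hjb⟩ := Submodule.mem_sup.1 (show w ∈ J ⊔ Ideal.span {a} from hw)
  obtain ⟨b, rfl⟩ := Ideal.mem_span_singleton'.1 hb
  have hr' : r = (gradedProj 𝒜 m v + a * (if δ ≤ m then gradedProj 𝒜 (m - δ) b else 0)) +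
      gradedProj 𝒜 m j := by
    conv_lhs => rw [← gradedProj_of_mem 𝒜 hr, ← hvw, ← hjb]
    have := gradedProj_smul_of_mem_left 𝒜 𝒜 ha b m
    rw [smul_eq_mul, smul_eq_mul] at this
    rw [map_add, map_add, mul_comm b a, this]
    ring
  rw [hr']
  refine Submodule.add_mem _ (hle' (Submodule.add_mem_sup (Submodule.mem_map_of_mem hv) ?_))
    (Submodule.mem_sup_right (hJ.gradedProj_mem hj m))
  exact ⟨_, ite_gradedProj_mem_shiftedPiece 𝒜 δ m b, rfl⟩

lemma spannedModulo_gradedPiece_sum {J : Ideal R} (hJ : J.IsHomogeneous 𝒜) {δ : ℕ} (hδ : 0 < δ)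
    {a : R} (ha : a ∈ 𝒜 δ) {g : ℕ → ℕ}
    (h : ∀ m, SpannedModulo (𝒜 m) ((J ⊔ Ideal.span {a}).restrictScalars k) (g m)) (m : ℕ) :
    SpannedModulo (𝒜 m) (J.restrictScalars k) (∑ j ∈ Finset.range (m + 1), g j) := by
  induction m using Nat.strong_induction_on with
  | _ m ih =>
    rw [Finset.sum_range_succ, add_comm]
    refine spannedModulo_gradedPiece_add 𝒜 hJ ha (fun x hx => J.mul_mem_left a hx) (h m) ?_
    intro hm
    refine (ih (m - δ) (by omega)).mono ?_
    exact Finset.sum_le_sum_of_subset (Finset.range_mono (by omega))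

lemma ringKrullDim_quotient_sup_span_le {J : Ideal R} [J.IsPrime] {x : R} (hx : x ∉ J) {e : ℕ}
    (h : ringKrullDim (R ⧸ J) ≤ (e + 1 : ℕ)) :
    ringKrullDim (R ⧸ (J ⊔ Ideal.span {x})) ≤ e := by
  have hne : (Ideal.Quotient.mk J x) ≠ 0 := by rwa [Ne, Ideal.Quotient.eq_zero_iff_mem]
  have h1 := ringKrullDim_quotient_succ_le_of_nonZeroDivisor
    (mem_nonZeroDivisors_of_ne_zero hne)
  have e1 : ringKrullDim (R ⧸ (J ⊔ Ideal.span {x})) =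
      ringKrullDim ((R ⧸ J) ⧸ Ideal.span {Ideal.Quotient.mk J x}) := by
    have := (DoubleQuot.quotQuotEquivQuotSup J (Ideal.span {x}))
    rw [Ideal.map_span, Set.image_singleton] at this
    exact (ringKrullDim_eq_of_ringEquiv this).symm
  rw [← e1] at h1
  have h2 := h1.trans h
  rw [Nat.cast_add, Nat.cast_one] at h2
  exact (ENat.WithBot.add_le_add_one_right_iff).1 h2

/-- The Hilbert function of a graded quotient `R/J` of dimension at most `e + 1` grows
at most like a polynomial of degree `e`. -/
theorem exists_spannedModulo_gradedPiece [IsNoetherianRing R] [Algebra.FiniteType k R]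
    (h0 : 𝒜 0 ≤ Submodule.span k {1}) (J : Ideal R) (hJ : J.IsHomogeneous 𝒜) (e : ℕ)
    (hdim : ringKrullDim (R ⧸ J) ≤ (e + 1 : ℕ)) :
    ∃ C : ℕ, ∀ m, SpannedModulo (𝒜 m) (J.restrictScalars k) (C * (m + 1) ^ e) := by
  induction J using WellFoundedGT.induction generalizing e with
  | ind J ih =>
    by_cases htop : J = ⊤
    · exact ⟨0, fun m => (SpannedModulo.of_le (by simp [htop])).mono (by simp)⟩
    have hlt : ∀ {x : R}, x ∉ J → J < J ⊔ Ideal.span {x} := fun {x} hx =>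
      left_lt_sup.2 fun hle => hx (hle (Ideal.mem_span_singleton_self x))
    have hhom : ∀ {x : R} {i : ℕ}, x ∈ 𝒜 i → (J ⊔ Ideal.span {x}).IsHomogeneous 𝒜 :=
      fun {x i} hx => hJ.sup (Ideal.homogeneous_span 𝒜 _ (by
        rintro y rfl
        exact ⟨i, hx⟩))
    by_cases hprime : J.IsPrime
    · by_cases hx : ∃ δ, 0 < δ ∧ ∃ x ∈ 𝒜 δ, x ∉ J
      · obtain ⟨δ, hδ, x, hxδ, hxJ⟩ := hx
        have hd := ringKrullDim_quotient_sup_span_le hxJ hdim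
        cases e with
        | zero =>
          have : Ring.KrullDimLE 0 (R ⧸ (J ⊔ Ideal.span {x})) := Ring.krullDimLE_iff.2 hd
          have : Module.Finite k (R ⧸ (J ⊔ Ideal.span {x})) :=
            (Module.finite_iff_krullDimLE_zero k _).2 this
          obtain ⟨t, ht⟩ := exists_gradedPiece_le_of_finite_quotient 𝒜 _ (hhom hxδ)
          let c := Module.finrank k (R ⧸ (J ⊔ Ideal.span {x}))
          refine ⟨t * c, fun m => ?_⟩
          refine (spannedModulo_gradedPiece_sum 𝒜 hJ hδ hxδ (g := fun j => if j < t then c else 0)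
            (fun j => ?_) m).mono ?_
          · split_ifs with hj
            · exact spannedModulo_of_finite_quotient _ _
            · exact SpannedModulo.of_le (ht j (not_lt.1 hj))
          · rw [← Finset.sum_filter, Finset.sum_const, pow_zero, mul_one, smul_eq_mul]
            refine Nat.mul_le_mul_right _ ?_
            calc _ ≤ (Finset.range t).card := Finset.card_le_card fun j hj => by
                  simp only [Finset.mem_filter] at hj
                  simpa using hj.2
              _ = t := Finset.card_range t
        | succ e =>
          obtain ⟨C, hC⟩ := ih _ (hlt hxJ) (hhom hxδ) e hd
          refine ⟨C, fun m => (spannedModulo_gradedPiece_sum 𝒜 hJ hδ hxδ hC m).mono ?_⟩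
          calc ∑ j ∈ Finset.range (m + 1), C * (j + 1) ^ e
              ≤ ∑ j ∈ Finset.range (m + 1), C * (m + 1) ^ e := by
                refine Finset.sum_le_sum fun j hj => ?_
                have := Finset.mem_range.1 hj
                gcongr
                omega
            _ = C * (m + 1) ^ (e + 1) := by
                rw [Finset.sum_const, Finset.card_range, smul_eq_mul]
                ring
      · push Not at hx
        refine ⟨1, fun m => SpannedModulo.mono (c := 1) ?_ (by
          rw [one_mul]; exact Nat.one_le_pow _ _ (by omega))⟩
        cases m with
        | zero => exact ⟨{1}, by simp, h0.trans (by simp)⟩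
        | succ m => exact (SpannedModulo.of_le (hx _ (by omega))).mono (Nat.zero_le _)
    · have : ∃ a b : R, SetLike.IsHomogeneousElem 𝒜 a ∧ SetLike.IsHomogeneousElem 𝒜 b ∧
          a * b ∈ J ∧ a ∉ J ∧ b ∉ J := by
        by_contra! hcon
        refine hprime (hJ.isPrime_of_homogeneous_mem_or_mem htop fun {x y} hx hy hxy => ?_)
        by_contra! hxy'
        exact hxy'.2 (hcon x y hx hy hxy hxy'.1)
      obtain ⟨a, b, ⟨δ, ha⟩, ⟨δ', hb⟩, hab, haJ, hbJ⟩ := this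
      have hdle : ∀ x : R, ringKrullDim (R ⧸ (J ⊔ Ideal.span {x})) ≤ (e + 1 : ℕ) := fun x =>
        (ringKrullDim_le_of_surjective (Ideal.Quotient.factor (le_sup_left))
          (Ideal.Quotient.factor_surjective _)).trans hdim
      obtain ⟨C, hC⟩ := ih _ (hlt haJ) (hhom ha) e (hdle a)
      obtain ⟨C', hC'⟩ := ih _ (hlt hbJ) (hhom hb) e (hdle b)
      refine ⟨C + C', fun m => ?_⟩
      rw [add_mul]
      refine spannedModulo_gradedPiece_add 𝒜 hJ ha (K := J ⊔ Ideal.span {b}) ?_ (hC m)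
        fun _ => (hC' (m - δ)).mono ?_
      · intro x hx
        obtain ⟨j, hj, y, hy, rfl⟩ := Submodule.mem_sup.1 hx
        obtain ⟨y, rfl⟩ := Ideal.mem_span_singleton'.1 hy
        rw [mul_add]
        refine J.add_mem (J.mul_mem_left _ hj) ?_
        rw [mul_left_comm]
        exact J.mul_mem_left _ hab
      · gcongr
        omega

end HilbertFunction

section GradedModule

variable {k : Type*} [Field k] {R : Type*} [CommRing R] [Algebra k R]
  (𝒜 : ℕ → Submodule k R) [GradedAlgebra 𝒜]
  {M : Type*} [AddCommGroup M] [Module R M] [Module k M] [IsScalarTower k R M]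
  (ℳ : ℕ → Submodule k M) [DirectSum.Decomposition ℳ] [SetLike.GradedSMul 𝒜 ℳ]

include ℳ in
omit [IsScalarTower k R M] in
lemma isHomogeneous_annihilator : (Module.annihilator R M).IsHomogeneous 𝒜 := by
  intro i r hr
  change gradedProj 𝒜 i r ∈ _
  rw [Module.mem_annihilator] at hr ⊢
  intro x
  induction x using DirectSum.Decomposition.inductionOn ℳ with
  | zero => simp
  | @homogeneous j y =>
    have h := gradedProj_smul_of_mem_right 𝒜 ℳ r y.2 (i + j)
    rw [hr, map_zero, if_pos (by omega), Nat.add_sub_cancel] at h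
    exact h.symm
  | add a b ha hb => rw [smul_add, ha, hb, add_zero]

lemma exists_spannedModulo_gradedPiece_module [Module.Finite R M] {J : Ideal R}
    (hJ : J ≤ Module.annihilator R M) {e C : ℕ}
    (hC : ∀ m, SpannedModulo (𝒜 m) (J.restrictScalars k) (C * (m + 1) ^ e)) :
    ∃ C' : ℕ, ∀ m, SpannedModulo (ℳ m) ⊥ (C' * (m + 1) ^ e) := by
  obtain ⟨T, deg, hdeg, hT⟩ := exists_homogeneous_generators ℳ (⊤ : Submodule R M)
    Module.Finite.fg_top (fun _ _ _ => Submodule.mem_top)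
  refine ⟨T.card * C, fun m => ?_⟩
  have key : SpannedModulo (T.sup fun x => (shiftedPiece 𝒜 (deg x) m).map
      ((LinearMap.toSpanSingleton R M x).restrictScalars k)) ⊥
      (∑ x ∈ T, C * (m + 1) ^ e) := by
    refine SpannedModulo.finset_sup T fun x _ => ?_
    unfold shiftedPiece
    split_ifs with h
    · refine (((hC (m - deg x)).map
        ((LinearMap.toSpanSingleton R M x).restrictScalars k)).mono_right ?_).mono ?_
      · rintro _ ⟨r, hr, rfl⟩
        exact Module.mem_annihilator.1 (hJ hr) x
      · gcongr
        omega
    · exact (SpannedModulo.of_le (by simp)).mono (Nat.zero_le _)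
  rw [Finset.sum_const, smul_eq_mul, ← mul_assoc] at key
  refine key.mono_left fun z hz => ?_
  obtain ⟨c, hc, rfl⟩ := gradedPiece_le_of_span_eq_top 𝒜 ℳ hdeg m hz (hT ▸ Submodule.mem_top)
  exact Submodule.sum_mem _ fun x hx =>
    Finset.le_sup (f := fun x => (shiftedPiece 𝒜 (deg x) m).map
      ((LinearMap.toSpanSingleton R M x).restrictScalars k)) hx ⟨c x, hc x hx, rfl⟩

lemma Ideal.span_finset_pow_card_mul_le {A : Type*} [CommSemiring A] (S : Finset A) (q : ℕ) :
    Ideal.span (S : Set A) ^ (S.card * q + 1) ≤ Ideal.span ((· ^ q) '' (S : Set A)) := by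
  classical
  induction S using Finset.induction_on with
  | empty => simp
  | insert a S ha ih =>
    rw [Finset.card_insert_of_notMem ha, add_mul, one_mul, add_right_comm, add_comm,
      Finset.coe_insert, Ideal.span_insert, Set.image_insert_eq, Ideal.span_insert]
    refine Ideal.sup_pow_add_le_pow_sup_pow.trans (sup_le_sup ?_ ih)
    rw [Ideal.span_singleton_pow]

lemma gradedPiece_le_pow {S : Finset R} {deg : R → ℕ} (hdeg : ∀ x ∈ S, x ∈ 𝒜 (deg x)) {t : ℕ}
    (ht : ∀ m, t ≤ m → ∀ z ∈ 𝒜 m, z ∈ Ideal.span (S : Set R)) (n m : ℕ)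
    (hm : t + n * S.sup deg ≤ m) {z : R} (hz : z ∈ 𝒜 m) : z ∈ Ideal.span (S : Set R) ^ n := by
  induction n generalizing m z with
  | zero => simp
  | succ n ih =>
    obtain ⟨c, hc, rfl⟩ := gradedPiece_le_of_span_eq_top 𝒜 𝒜 hdeg m hz (ht m (by omega) z hz)
    refine Submodule.sum_mem _ fun x hx => ?_
    have hx' := hc x hx
    rw [pow_succ, smul_eq_mul]
    refine Ideal.mul_mem_mul ?_ (Ideal.subset_span hx)
    unfold shiftedPiece at hx'
    split_ifs at hx' with h
    · refine ih (m - deg x) ?_ hx'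
      have := Finset.le_sup (f := deg) hx
      rw [add_mul] at hm
      omega
    · rw [(Submodule.mem_bot k).1 hx']
      exact Submodule.zero_mem _

lemma Ideal.span_pow_le_frobeniusPow (S : Set R) (q : ℕ) :
    Ideal.span ((· ^ q) '' S) ≤ (Ideal.span S).frobeniusPow q :=
  Ideal.span_mono (Set.image_mono Ideal.subset_span)

lemma Ideal.frobeniusPow_span {A : Type*} [CommRing A] (p : ℕ) [Fact p.Prime] [CharP A p]
    (S : Set A) (n : ℕ) :
    (Ideal.span S).frobeniusPow (p ^ n) = Ideal.span ((· ^ (p ^ n)) '' S) := by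
  have := Ideal.map_span (iterateFrobenius A p n) S
  rwa [Ideal.map, show ⇑(iterateFrobenius A p n) = (· ^ (p ^ n)) from
    funext (iterateFrobenius_def p n)] at this

omit [IsScalarTower k R M] in
/-- The quotient `M / I^{[q]} M` vanishes in degrees at least `T q`, with `T` independent
of `q`. -/
lemma exists_gradedPiece_le_frobeniusPow_smul_top [Module.Finite R M] {I : Ideal R}
    {S : Finset R} {deg : R → ℕ} (hdeg : ∀ x ∈ S, x ∈ 𝒜 (deg x))
    (hS : Ideal.span (S : Set R) = I) {t : ℕ} (ht : ∀ m, t ≤ m → 𝒜 m ≤ I.restrictScalars k) :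
    ∃ T : ℕ, ∀ q m, 0 < q → T * q ≤ m →
      ∀ z ∈ ℳ m, z ∈ I.frobeniusPow q • (⊤ : Submodule R M) := by
  subst hS
  obtain ⟨G, degG, hdegG, hG⟩ := exists_homogeneous_generators ℳ (⊤ : Submodule R M)
    Module.Finite.fg_top (fun _ _ _ => Submodule.mem_top)
  refine ⟨G.sup degG + t + (S.card + 1) * S.sup deg, fun q m hq hm z hz => ?_⟩
  obtain ⟨c, hc, rfl⟩ := gradedPiece_le_of_span_eq_top 𝒜 ℳ hdegG m hz (hG ▸ Submodule.mem_top)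
  refine Submodule.sum_mem _ fun x hx => ?_
  have hx' := hc x hx
  refine Submodule.smul_mem_smul ?_ Submodule.mem_top
  unfold shiftedPiece at hx'
  split_ifs at hx' with h
  · refine Ideal.span_pow_le_frobeniusPow _ _ (Ideal.span_finset_pow_card_mul_le S q ?_)
    refine gradedPiece_le_pow 𝒜 hdeg ht _ (m - degG x) ?_ hx'
    have h1 := Finset.le_sup (f := degG) hx
    have h2 : G.sup degG + t + (S.card * q + 1) * S.sup deg ≤
        (G.sup degG + t + (S.card + 1) * S.sup deg) * q := by
      nlinarith [Nat.le_mul_of_pos_right (G.sup degG + t + S.sup deg) hq]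
    omega
  · rw [(Submodule.mem_bot k).1 hx']
    exact Submodule.zero_mem _

end GradedModule

section GradedPieceLen

variable {k : Type*} [Field k] {M : Type*} [AddCommGroup M] [Module k M]
  (ℳ : ℕ → Submodule k M)

lemma gradedPieceLen_add_finrank (P : Submodule k M) (m : ℕ)
    [FiniteDimensional k (ℳ m)] :
    gradedPieceLen k ℳ P m + Module.finrank k ↥(ℳ m ⊓ P) = Module.finrank k (ℳ m) := by
  rw [gradedPieceLen, ← Submodule.finrank_quotient_add_finrank (P.comap (ℳ m).subtype),
    ← Submodule.map_comap_subtype,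
    (Submodule.equivMapOfInjective _ (ℳ m).injective_subtype _).finrank_eq]

lemma gradedPieceLen_eq_zero {P : Submodule k M} {m : ℕ} (h : ℳ m ≤ P) :
    gradedPieceLen k ℳ P m = 0 := by
  have : P.comap (ℳ m).subtype = ⊤ := by
    rw [eq_top_iff]
    exact fun x _ => h x.2
  rw [gradedPieceLen, this]
  exact Module.finrank_zero_of_subsingleton

end GradedPieceLen

lemma LinearMap.map_mem_smul_top {R N N' : Type*} [CommRing R] [AddCommGroup N] [Module R N]
    [AddCommGroup N'] [Module R N'] (α : N →ₗ[R] N') (J : Ideal R) {x : N}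
    (hx : x ∈ J • (⊤ : Submodule R N)) : α x ∈ J • (⊤ : Submodule R N') := by
  have h : α x ∈ (J • (⊤ : Submodule R N)).map α := Submodule.mem_map_of_mem hx
  rw [Submodule.map_smul''] at h
  exact Submodule.smul_mono (le_refl J) le_top h

section Comparison

variable {k : Type*} [Field k] {R : Type*} [CommRing R] [Algebra k R]
  (𝒜 : ℕ → Submodule k R) [GradedAlgebra 𝒜]
  {N : Type*} [AddCommGroup N] [Module R N] [Module k N] [IsScalarTower k R N]
  (𝒩 : ℕ → Submodule k N) [DirectSum.Decomposition 𝒩] [SetLike.GradedSMul 𝒜 𝒩]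
  {N' : Type*} [AddCommGroup N'] [Module R N'] [Module k N'] [IsScalarTower k R N']
  (𝒩' : ℕ → Submodule k N') [DirectSum.Decomposition 𝒩'] [SetLike.GradedSMul 𝒜 𝒩']
  {Q'' : Type*} [AddCommGroup Q''] [Module R Q''] [Module k Q''] [IsScalarTower k R Q'']
  (𝒬 : ℕ → Submodule k Q'') [DirectSum.Decomposition 𝒬]
  {α : N →ₗ[R] N'} {β : N' →ₗ[R] Q''}

/-- A graded exact sequence `N → N' → Q'' → 0` in degree `j`. -/
lemma spannedModulo_map_of_exact (hβsurj : Function.Surjective β)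
    (hexact : Function.Exact α β) (hαdeg : ∀ j : ℕ, ∀ x ∈ 𝒩 j, α x ∈ 𝒩' j)
    (hβdeg : ∀ j : ℕ, ∀ x ∈ 𝒩' j, β x ∈ 𝒬 j) {j c : ℕ} (h : SpannedModulo (𝒬 j) ⊥ c) :
    SpannedModulo (𝒩' j) ((𝒩 j).map (α.restrictScalars k)) c := by
  have := h.finite
  refine (SpannedModulo.of_linearMap (β.restrictScalars k) (𝒬 j) ?_ (hβdeg j) ?_).mono
    h.finrank_le
  · intro y hy
    obtain ⟨x, rfl⟩ := hβsurj y
    refine ⟨gradedProj 𝒩' j x, gradedProj_mem 𝒩' j x, ?_⟩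
    have := map_gradedProj 𝒩' 𝒬 β.toAddMonoidHom hβdeg j x
    exact this.trans (gradedProj_of_mem 𝒬 hy)
  · intro x hx hx0
    obtain ⟨y, rfl⟩ := (hexact x).1 hx0
    refine ⟨gradedProj 𝒩 j y, gradedProj_mem 𝒩 j y, ?_⟩
    have := map_gradedProj 𝒩 𝒩' α.toAddMonoidHom hαdeg j y
    exact this.trans (gradedProj_of_mem 𝒩' hx)

omit [GradedAlgebra 𝒜] [DirectSum.Decomposition 𝒩] in
/-- Modulo the image of `J N`, the degree `m` piece of `J N'` is spanned by the products of the
generators of `J` with lifts of elements of the cokernel of `N → N'`. -/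
lemma spannedModulo_gradedPiece_inf_smul_top {C e : ℕ}
    (hC : ∀ j, SpannedModulo (𝒩' j) ((𝒩 j).map (α.restrictScalars k)) (C * (j + 1) ^ e))
    {ι : Type*} {S : Finset ι} {g : ι → R} {deg : ι → ℕ} (hdeg : ∀ x ∈ S, g x ∈ 𝒜 (deg x))
    {J : Ideal R} (hJ : J = Ideal.span (g '' (S : Set ι))) (m : ℕ) :
    SpannedModulo (𝒩' m ⊓ (J • (⊤ : Submodule R N')).restrictScalars k)
      ((𝒩 m ⊓ (J • (⊤ : Submodule R N)).restrictScalars k).map (α.restrictScalars k))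
      (S.card * (C * (m + 1) ^ e)) := by
  have hmem : ∀ x ∈ S, ∀ y : N, g x • y ∈ (J • (⊤ : Submodule R N)).restrictScalars k :=
    fun x hx y => by
      have hgx : g x ∈ J := by
        rw [hJ]
        exact Ideal.subset_span (Set.mem_image_of_mem g hx)
      rw [Submodule.restrictScalars_mem]
      exact Submodule.smul_mem_smul hgx Submodule.mem_top
  have key : SpannedModulo (S.sup fun x => (shiftedPiece 𝒩' (deg x) m).map
      (Algebra.lsmul k k N' (g x)))
      ((𝒩 m ⊓ (J • (⊤ : Submodule R N)).restrictScalars k).map (α.restrictScalars k))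
      (∑ x ∈ S, C * (m + 1) ^ e) := by
    refine SpannedModulo.finset_sup S fun x hx => ?_
    unfold shiftedPiece
    split_ifs with h
    · refine (((hC (m - deg x)).map (Algebra.lsmul k k N' (g x))).mono_right ?_).mono ?_
      · rintro _ ⟨_, ⟨y, hy, rfl⟩, rfl⟩
        refine ⟨g x • y, ⟨?_, hmem x hx y⟩, map_smul α (g x) y⟩
        have := SetLike.GradedSMul.smul_mem (hdeg x hx) hy
        rwa [vadd_eq_add, Nat.add_sub_cancel' h] at this
      · gcongr
        omega
    · exact (SpannedModulo.of_le (by simp)).mono (Nat.zero_le _)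
  rw [Finset.sum_const, smul_eq_mul] at key
  refine key.mono_left ?_
  rintro z ⟨hz, hzP⟩
  rw [hJ] at hzP
  obtain ⟨y, hy, rfl⟩ := exists_eq_sum_of_mem_span_smul_top 𝒜 𝒩' hdeg m hz hzP
  exact Submodule.sum_mem _ fun x hx =>
    Finset.le_sup (f := fun x => (shiftedPiece 𝒩' (deg x) m).map
      (Algebra.lsmul k k N' (g x))) hx ⟨y x, hy x hx, rfl⟩

omit [GradedAlgebra 𝒜] [DirectSum.Decomposition 𝒩] in
/-- The colengths of `J N` and `J N'` in degree `m` differ by a bounded multiple of the Hilbert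
function of the cokernel, uniformly in the degrees of the generators of `J`. -/
lemma abs_gradedPieceLen_sub_le (hαinj : Function.Injective α)
    (hαdeg : ∀ j : ℕ, ∀ x ∈ 𝒩 j, α x ∈ 𝒩' j) {C e : ℕ}
    (hC : ∀ j, SpannedModulo (𝒩' j) ((𝒩 j).map (α.restrictScalars k)) (C * (j + 1) ^ e))
    {ι : Type*} {S : Finset ι} {g : ι → R} {deg : ι → ℕ} (hdeg : ∀ x ∈ S, g x ∈ 𝒜 (deg x))
    {J : Ideal R} (hJ : J = Ideal.span (g '' (S : Set ι))) (m : ℕ)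
    [FiniteDimensional k (𝒩 m)] [FiniteDimensional k (𝒩' m)] :
    |(gradedPieceLen k 𝒩' ((J • (⊤ : Submodule R N')).restrictScalars k) m : ℝ) -
      gradedPieceLen k 𝒩 ((J • (⊤ : Submodule R N)).restrictScalars k) m| ≤
      ((S.card + 1) * C * (m + 1) ^ e : ℕ) := by
  have hspan := spannedModulo_gradedPiece_inf_smul_top 𝒜 𝒩 𝒩' hC hdeg hJ m
  have hmapP : (𝒩 m ⊓ (J • (⊤ : Submodule R N)).restrictScalars k).map (α.restrictScalars k) ≤
      𝒩' m ⊓ (J • (⊤ : Submodule R N')).restrictScalars k := by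
    rintro _ ⟨x, ⟨hx, hxP⟩, rfl⟩
    refine ⟨hαdeg m x hx, ?_⟩
    rw [SetLike.mem_coe, Submodule.restrictScalars_mem] at hxP
    exact (Submodule.restrictScalars_mem k _ _).2 (α.map_mem_smul_top J hxP)
  have hmap : (𝒩 m).map (α.restrictScalars k) ≤ 𝒩' m := by
    rintro _ ⟨x, hx, rfl⟩
    exact hαdeg m x hx
  have hfinj : Function.Injective (α.restrictScalars k) := hαinj
  generalize (J • (⊤ : Submodule R N)).restrictScalars k = P at *
  generalize (J • (⊤ : Submodule R N')).restrictScalars k = P' at *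
  generalize α.restrictScalars k = f at *
  have h1 := gradedPieceLen_add_finrank 𝒩 P m
  have h2 := gradedPieceLen_add_finrank 𝒩' P' m
  have : FiniteDimensional k ↥(𝒩' m ⊓ P') := Submodule.finiteDimensional_inf_left _ _
  have : FiniteDimensional k ↥(𝒩 m ⊓ P) := Submodule.finiteDimensional_inf_left _ _
  have h3 := (hC m).finrank_le_add
  have h4 := hspan.finrank_le_add
  have h5 := Submodule.finrank_mono hmapP
  have h6 := Submodule.finrank_mono hmap
  rw [← (Submodule.equivMapOfInjective f hfinj _).finrank_eq] at h3 h4 h5 h6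
  have e1 : (S.card + 1) * C * (m + 1) ^ e = S.card * (C * (m + 1) ^ e) + C * (m + 1) ^ e := by
    ring
  rw [e1, abs_sub_le_iff]
  constructor
  · rw [sub_le_iff_le_add]
    norm_cast
    omega
  · rw [sub_le_iff_le_add]
    norm_cast
    omega

end Comparison

lemma ringKrullDim_quotient_le_of_le {R : Type*} [CommRing R] (J : Ideal R) {d : ℕ}
    (h : ringKrullDim R ≤ d) : ringKrullDim (R ⧸ J) ≤ d :=
  (ringKrullDim_le_of_surjective _ Ideal.Quotient.mk_surjective).trans h

/-- A sequence of functions bounded by `K / pⁿ` converges uniformly to zero. -/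
lemma tendstoUniformlyOn_zero_of_abs_le_div_pow {u : ℕ → ℝ → ℝ} {s : Set ℝ} {p : ℕ} (hp : 1 < p)
    (K : ℝ) (h : ∀ n, ∀ x ∈ s, |u n x| ≤ K / (p : ℝ) ^ n) :
    TendstoUniformlyOn u 0 atTop s := by
  have hlim : Tendsto (fun n : ℕ => K / (p : ℝ) ^ n) atTop (𝓝 0) :=
    tendsto_const_nhds.div_atTop (tendsto_pow_atTop_atTop_of_one_lt (by exact_mod_cast hp))
  rw [Metric.tendstoUniformlyOn_iff]
  intro ε hε
  filter_upwards [hlim.eventually (gt_mem_nhds hε)] with n hn x hx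
  rw [dist_comm, Pi.zero_apply, dist_zero_right, Real.norm_eq_abs]
  exact (h n x hx).trans_lt hn

/-- (Lemma 4.2 of the paper.)  For a graded pair `(R, I)` with
`gcd {m > 0 | R_m ≠ 0} = 1` and a short exact sequence `0 → N → N' → Q'' → 0` of finitely
generated graded `R`-modules with degree-0 maps, where `dim supp Q'' < d`, the sequence
`{f_n(N_R, I)}` converges uniformly iff `{f_n(N'_R, I)}` does, and then the limits agree. -/
theorem statement9
    (k : Type*) [Field k] [PerfectField k] (p : ℕ) [Fact p.Prime] [CharP k p]
    (R : Type*) [CommRing R] [IsDomain R] [IsNoetherianRing R] [Algebra k R]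
    [Algebra.FiniteType k R]
    (𝒜 : ℕ → Submodule k R) [GradedAlgebra 𝒜]
    (h𝒜0 : 𝒜 0 ≤ Submodule.span k {1})
    (d : ℕ) (hd : 2 ≤ d) (hdim : ringKrullDim R = d)
    (I : Ideal R) (hI : I.IsHomogeneous 𝒜) (hIcolen : FiniteDimensional k (R ⧸ I))
    (hgcd : ∀ c : ℕ, (∀ m, 0 < m → 𝒜 m ≠ ⊥ → c ∣ m) → c = 1)
    -- the three finitely generated graded modules
    (N : Type*) [AddCommGroup N] [Module R N] [Module k N] [IsScalarTower k R N]
    [Module.Finite R N]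
    (𝒩 : ℕ → Submodule k N) [DirectSum.Decomposition 𝒩] [SetLike.GradedSMul 𝒜 𝒩]
    (N' : Type*) [AddCommGroup N'] [Module R N'] [Module k N'] [IsScalarTower k R N']
    [Module.Finite R N']
    (𝒩' : ℕ → Submodule k N') [DirectSum.Decomposition 𝒩'] [SetLike.GradedSMul 𝒜 𝒩']
    (Q'' : Type*) [AddCommGroup Q''] [Module R Q''] [Module k Q''] [IsScalarTower k R Q'']
    [Module.Finite R Q'']
    (𝒬 : ℕ → Submodule k Q'') [DirectSum.Decomposition 𝒬] [SetLike.GradedSMul 𝒜 𝒬]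
    -- the short exact sequence of graded degree-0 maps
    (α : N →ₗ[R] N') (β : N' →ₗ[R] Q'')
    (hαinj : Function.Injective α) (hβsurj : Function.Surjective β)
    (hexact : Function.Exact α β)
    (hαdeg : ∀ j : ℕ, ∀ x ∈ 𝒩 j, α x ∈ 𝒩' j)
    (hβdeg : ∀ j : ℕ, ∀ x ∈ 𝒩' j, β x ∈ 𝒬 j)
    -- `supp dim Q'' < d`
    (hsupp : ringKrullDim (R ⧸ Module.annihilator R Q'') < (d : WithBot (WithTop ℕ))) :
    ((∃ F : ℝ → ℝ, TendstoUniformlyOn (fun n => hkStep k 𝒩 I d 1 p n) F atTop (Set.Ici 0))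
      ↔ (∃ F : ℝ → ℝ,
          TendstoUniformlyOn (fun n => hkStep k 𝒩' I d 1 p n) F atTop (Set.Ici 0))) ∧
    (∀ F F' : ℝ → ℝ,
      TendstoUniformlyOn (fun n => hkStep k 𝒩 I d 1 p n) F atTop (Set.Ici 0) →
      TendstoUniformlyOn (fun n => hkStep k 𝒩' I d 1 p n) F' atTop (Set.Ici 0) →
      ∀ x : ℝ, 0 ≤ x → F x = F' x) := by
  have hp : p.Prime := Fact.out
  have : CharP R p := charP_of_injective_algebraMap (algebraMap k R).injective p
  obtain ⟨e, rfl⟩ : ∃ e, d = e + 2 := ⟨d - 2, by omega⟩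
  -- Hilbert functions
  obtain ⟨C₀, hC₀⟩ := exists_spannedModulo_gradedPiece 𝒜 h𝒜0 ⊥ (Ideal.IsHomogeneous.bot 𝒜) (e + 1)
    (ringKrullDim_quotient_le_of_le _ hdim.le)
  obtain ⟨C₁, hC₁⟩ := exists_spannedModulo_gradedPiece_module 𝒜 𝒩 bot_le hC₀
  obtain ⟨C₂, hC₂⟩ := exists_spannedModulo_gradedPiece_module 𝒜 𝒩' bot_le hC₀
  have hN : ∀ m, FiniteDimensional k (𝒩 m) := fun m => (hC₁ m).finite
  have hN' : ∀ m, FiniteDimensional k (𝒩' m) := fun m => (hC₂ m).finite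
  have hsupp' : ringKrullDim (R ⧸ Module.annihilator R Q'') ≤ (e + 1 : ℕ) :=
    ENat.WithBot.lt_add_one_iff.1 (by exact_mod_cast hsupp)
  obtain ⟨C₃, hC₃⟩ := exists_spannedModulo_gradedPiece 𝒜 h𝒜0 _
    (isHomogeneous_annihilator 𝒜 𝒬) e hsupp'
  obtain ⟨C, hC⟩ := exists_spannedModulo_gradedPiece_module 𝒜 𝒬 le_rfl hC₃
  have hC' := fun j => spannedModulo_map_of_exact 𝒩 𝒩' 𝒬 hβsurj hexact hαdeg hβdeg (hC j)
  -- generators of `I` and vanishing in large degrees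
  obtain ⟨S, deg, hdeg, hS⟩ := exists_homogeneous_generators 𝒜 I
    (IsNoetherian.noetherian I) (fun x hx j => hI.gradedProj_mem hx j)
  have : Module.Finite k (R ⧸ I) := hIcolen
  obtain ⟨t, ht⟩ := exists_gradedPiece_le_of_finite_quotient 𝒜 I hI
  obtain ⟨T, hT⟩ := exists_gradedPiece_le_frobeniusPow_smul_top 𝒜 𝒩 hdeg hS ht
  obtain ⟨T', hT'⟩ := exists_gradedPiece_le_frobeniusPow_smul_top 𝒜 𝒩' hdeg hS ht
  have hbound : ∀ n, ∀ x ∈ Set.Ici (0 : ℝ),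
      |hkStep k 𝒩' I (e + 2) 1 p n x - hkStep k 𝒩 I (e + 2) 1 p n x| ≤
        ((S.card + 1) * C * (T + T') ^ e : ℕ) / (p : ℝ) ^ n := by
    intro n x _
    have hq : 0 < p ^ n := pow_pos hp.pos n
    have hqR : (0 : ℝ) < (p : ℝ) ^ n := by exact_mod_cast hq
    simp only [hkStep, Finset.sum_range_one, mul_one, add_zero]
    set m := ⌊x * (p ^ n : ℕ)⌋₊
    rw [← sub_div, abs_div, abs_of_pos (pow_pos hqR (e + 2 - 1)),
      show e + 2 - 1 = e + 1 by omega, div_le_div_iff₀ (by positivity) hqR]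
    by_cases hm : (T + T') * p ^ n ≤ m
    · rw [add_mul] at hm
      rw [gradedPieceLen_eq_zero 𝒩 (fun z hz => hT (p ^ n) m hq (by omega) z hz),
        gradedPieceLen_eq_zero 𝒩' (fun z hz => hT' (p ^ n) m hq (by omega) z hz)]
      simp only [Nat.cast_zero, sub_zero, abs_zero, zero_mul]
      positivity
    · have h := abs_gradedPieceLen_sub_le 𝒜 𝒩 𝒩' hαinj hαdeg hC'
        (S := S) (g := fun x => x ^ p ^ n) (deg := fun x => p ^ n • deg x)
        (fun x hx => SetLike.pow_mem_graded _ (hdeg x hx)) (J := I.frobeniusPow (p ^ n))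
        (by rw [← hS]; exact Ideal.frobeniusPow_span p _ n) m
      have h' : (S.card + 1) * C * (m + 1) ^ e ≤
          (S.card + 1) * C * (T + T') ^ e * (p ^ n) ^ e := by
        rw [mul_assoc _ (_ ^ e), ← mul_pow]
        gcongr
        omega
      have h'' : (((S.card + 1) * C * (m + 1) ^ e : ℕ) : ℝ) ≤
          ((S.card + 1) * C * (T + T') ^ e : ℕ) * ((p : ℝ) ^ n) ^ e := by
        exact_mod_cast h'
      calc _ ≤ ((S.card + 1) * C * (T + T') ^ e : ℕ) * ((p : ℝ) ^ n) ^ e * (p : ℝ) ^ n :=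
            mul_le_mul_of_nonneg_right (h.trans h'') hqR.le
        _ = _ := by ring
  have hdiff := tendstoUniformlyOn_zero_of_abs_le_div_pow hp.one_lt _ hbound
  have hto : ∀ F : ℝ → ℝ,
      TendstoUniformlyOn (fun n => hkStep k 𝒩 I (e + 2) 1 p n) F atTop (Set.Ici 0) →
      TendstoUniformlyOn (fun n => hkStep k 𝒩' I (e + 2) 1 p n) F atTop (Set.Ici 0) := by
    intro F hF
    refine ((hF.add hdiff).congr (Eventually.of_forall fun n x _ => ?_)).congr_right
      fun x _ => ?_
    · simp
    · simp
  have hfrom : ∀ F : ℝ → ℝ,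
      TendstoUniformlyOn (fun n => hkStep k 𝒩' I (e + 2) 1 p n) F atTop (Set.Ici 0) →
      TendstoUniformlyOn (fun n => hkStep k 𝒩 I (e + 2) 1 p n) F atTop (Set.Ici 0) := by
    intro F hF
    refine ((hF.sub hdiff).congr (Eventually.of_forall fun n x _ => ?_)).congr_right
      fun x _ => ?_
    · simp
    · simp
  refine ⟨⟨fun ⟨F, hF⟩ => ⟨F, hto F hF⟩, fun ⟨F, hF⟩ => ⟨F, hfrom F hF⟩⟩, ?_⟩
  intro F F' hF hF' x hx
  exact tendsto_nhds_unique ((hto F hF).tendsto_at hx) (hF'.tendsto_at hx)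
end
end

section
/- Let S → R be an injective degree-preserving module-finite homomorphism of ℕ-graded Noetherian domains, where (S, I) is a graded pair of dimension d and dim R = d. Set m₀ = gcd{n > 0 : S_n ≠ 0} and n₀ = gcd{n > 0 : R_n ≠ 0}. Then l₀ := m₀/n₀ is a positive integer, and for all x ≥ 0: l₀·f_{R,IR}(x·l₀) = f_{R_S,I}(x) = rank_S(R)·f_{S,I}(x), where f_{R,IR} is the HK density function of the graded pair (R, IR), f_{R_S,I} is the HK density function of R viewed as a finitely generated graded S-module with respect to (S, I), and rank_S(R) is the generic rank of R as an S-module. In particular f_{R,IR} = f_{R_S,I} if m₀ = n₀. -/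
open Filter MeasureTheory Topology

noncomputable section

namespace HKDensity

/-- `W` is contained in `V` up to the span of at most `N` vectors. -/
def CoveredBy {k M : Type*} [Field k] [AddCommGroup M] [Module k M]
    (V W : Submodule k M) (N : ℕ) : Prop :=
  ∃ s : Finset M, s.card ≤ N ∧ W ≤ V ⊔ Submodule.span k (s : Set M)

namespace CoveredBy

variable {k M M' : Type*} [Field k] [AddCommGroup M] [Module k M] [AddCommGroup M'] [Module k M']

lemma of_le {V W : Submodule k M} (h : W ≤ V) (N : ℕ) : CoveredBy V W N :=
  ⟨∅, by simp, by simpa using h⟩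

lemma mono {V V' W W' : Submodule k M} {N N' : ℕ} (h : CoveredBy V W N)
    (hV : V ≤ V') (hW : W' ≤ W) (hN : N ≤ N') : CoveredBy V' W' N' := by
  obtain ⟨s, hs, hs'⟩ := h
  exact ⟨s, hs.trans hN, hW.trans (hs'.trans (sup_le_sup_right hV _))⟩

lemma trans {V W X : Submodule k M} {N N' : ℕ} (h : CoveredBy V W N)
    (h' : CoveredBy W X N') : CoveredBy V X (N + N') := by
  classical
  obtain ⟨s, hs, hs'⟩ := h
  obtain ⟨t, ht, ht'⟩ := h'
  refine ⟨s ∪ t, (Finset.card_union_le _ _).trans (add_le_add hs ht), ht'.trans ?_⟩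
  rw [Finset.coe_union, Submodule.span_union, ← sup_assoc]
  exact sup_le_sup_right hs' _

lemma sup {V W W' : Submodule k M} {N N' : ℕ} (h : CoveredBy V W N)
    (h' : CoveredBy V W' N') : CoveredBy V (W ⊔ W') (N + N') := by
  classical
  obtain ⟨s, hs, hs'⟩ := h
  obtain ⟨t, ht, ht'⟩ := h'
  refine ⟨s ∪ t, (Finset.card_union_le _ _).trans (add_le_add hs ht), ?_⟩
  rw [Finset.coe_union, Submodule.span_union]
  refine sup_le (hs'.trans ?_) (ht'.trans ?_)
  · exact sup_le_sup_left le_sup_left _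
  · exact sup_le_sup_left le_sup_right _

lemma iSup {ι : Type*} [Fintype ι] {V : Submodule k M} {W : ι → Submodule k M} {N : ι → ℕ}
    (h : ∀ i, CoveredBy V (W i) (N i)) : CoveredBy V (⨆ i, W i) (∑ i, N i) := by
  classical
  choose s hs hs' using h
  refine ⟨Finset.univ.biUnion s,
    Finset.card_biUnion_le.trans (Finset.sum_le_sum fun i _ => hs i), iSup_le fun i => ?_⟩
  refine (hs' i).trans (sup_le_sup_left (Submodule.span_mono ?_) _)
  exact_mod_cast Finset.subset_biUnion_of_mem s (Finset.mem_univ i)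

lemma map {σ : k →+* k} [RingHomSurjective σ] (f : M →ₛₗ[σ] M') {V W : Submodule k M} {N : ℕ}
    (h : CoveredBy V W N) : CoveredBy (V.map f) (W.map f) N := by
  classical
  obtain ⟨s, hs, hs'⟩ := h
  refine ⟨s.image f, Finset.card_image_le.trans hs, ?_⟩
  refine (Submodule.map_mono hs').trans ?_
  rw [Submodule.map_sup, Submodule.map_span, Finset.coe_image]

lemma finrank_le {V W : Submodule k M} {N : ℕ} (h : CoveredBy V W N) [FiniteDimensional k V] :
    Module.finrank k W ≤ Module.finrank k V + N := by
  obtain ⟨s, hs, hs'⟩ := h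
  refine (Submodule.finrank_mono hs').trans ?_
  refine (Submodule.finrank_add_le_finrank_add_finrank V _).trans ?_
  exact Nat.add_le_add_left ((finrank_span_finset_le_card s).trans hs) _

lemma finiteDimensional {V W : Submodule k M} {N : ℕ} (h : CoveredBy V W N)
    [FiniteDimensional k V] : FiniteDimensional k W := by
  obtain ⟨s, hs, hs'⟩ := h
  exact Submodule.finiteDimensional_of_le hs'

end CoveredBy

/-- Polynomial growth of order `r`: bounded partial sums for `r = 0`, and values of size
`O(m ^ (r - 1))` for `r ≥ 1`. -/
def HasGrowth (h : ℕ → ℕ) : ℕ → Prop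
  | 0 => ∃ C, ∀ m, ∑ j ∈ Finset.range (m + 1), h j ≤ C
  | r + 1 => ∃ C, ∀ m, h m ≤ C * (m + 1) ^ r

lemma HasGrowth.add {h h' : ℕ → ℕ} {r : ℕ} (H : HasGrowth h r) (H' : HasGrowth h' r) :
    HasGrowth (fun m => h m + h' m) r := by
  cases r with
  | zero =>
    obtain ⟨C, hC⟩ := H
    obtain ⟨C', hC'⟩ := H'
    exact ⟨C + C', fun m => by
      rw [Finset.sum_add_distrib]; exact add_le_add (hC m) (hC' m)⟩
  | succ r =>
    obtain ⟨C, hC⟩ := H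
    obtain ⟨C', hC'⟩ := H'
    exact ⟨C + C', fun m => by rw [add_mul]; exact add_le_add (hC m) (hC' m)⟩

lemma HasGrowth.shift {h : ℕ → ℕ} {r : ℕ} (H : HasGrowth h r) (e : ℕ) :
    HasGrowth (fun m => if e ≤ m then h (m - e) else 0) r := by
  cases r with
  | zero =>
    obtain ⟨C, hC⟩ := H
    refine ⟨C, fun m => ?_⟩
    refine le_trans ?_ (hC m)
    rw [← Finset.sum_filter]
    have hinj : Set.InjOn (fun j => j - e) ((Finset.range (m + 1)).filter (e ≤ ·) : Set ℕ) := by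
      intro a ha b hb hab
      simp only [Finset.coe_filter, Set.mem_ofPred_eq] at ha hb
      simp only at hab
      omega
    rw [← Finset.sum_image (f := h) hinj]
    refine Finset.sum_le_sum_of_subset fun j hj => ?_
    simp only [Finset.mem_image, Finset.mem_filter, Finset.mem_range] at hj ⊢
    omega
  | succ r =>
    obtain ⟨C, hC⟩ := H
    refine ⟨C, fun m => ?_⟩
    dsimp only
    split_ifs with hm
    · refine (hC _).trans (Nat.mul_le_mul_left _ (Nat.pow_le_pow_left (by omega) _))
    · exact Nat.zero_le _

lemma HasGrowth.sum {h : ℕ → ℕ} {r : ℕ} (H : HasGrowth h r) :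
    HasGrowth (fun m => ∑ j ∈ Finset.range (m + 1), h j) (r + 1) := by
  cases r with
  | zero =>
    obtain ⟨C, hC⟩ := H
    exact ⟨C, fun m => by simpa using hC m⟩
  | succ r =>
    obtain ⟨C, hC⟩ := H
    refine ⟨C, fun m => ?_⟩
    calc ∑ j ∈ Finset.range (m + 1), h j ≤ ∑ j ∈ Finset.range (m + 1), C * (m + 1) ^ r := by
          refine Finset.sum_le_sum fun j hj => (hC j).trans ?_
          rw [Finset.mem_range] at hj
          exact Nat.mul_le_mul_left _ (Nat.pow_le_pow_left (by omega) _)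
      _ = C * (m + 1) ^ (r + 1) := by
          rw [Finset.sum_const, Finset.card_range, smul_eq_mul, pow_succ]; ring

lemma hasGrowth_unit (r : ℕ) : HasGrowth (fun m => if m = 0 then 1 else 0) r := by
  cases r with
  | zero => exact ⟨1, fun m => by simp⟩
  | succ r =>
    refine ⟨1, fun m => ?_⟩
    dsimp only
    split_ifs
    · rw [one_mul]; exact Nat.one_le_pow _ _ (by omega)
    · exact Nat.zero_le _

lemma hasGrowth_zero (r : ℕ) : HasGrowth (fun _ => 0) r := by
  cases r with
  | zero => exact ⟨0, fun m => by simp⟩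
  | succ r => exact ⟨0, fun m => by simp⟩

lemma le_of_add_one_le_natCast_succ {x : WithBot ℕ∞} {r : ℕ}
    (h : x + 1 ≤ ((r + 1 : ℕ) : WithBot ℕ∞)) : x ≤ r := by
  induction x using WithBot.recBotCoe with
  | bot => exact bot_le
  | coe y =>
    have h' : y + 1 ≤ ((r + 1 : ℕ) : ℕ∞) := by exact_mod_cast h
    have h2 : y ≤ (r : ℕ∞) := by
      rw [Nat.cast_add, Nat.cast_one] at h'
      exact (ENat.add_le_add_iff_right ENat.one_ne_top).1 h'
    exact_mod_cast h2

section Hilbert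

variable {k A : Type*} [Field k] [CommRing A] [Algebra k A] (𝒜 : ℕ → Submodule k A)
  [GradedAlgebra 𝒜]

/-- The degree-`m` part of an ideal. -/
def idealPiece (I : Ideal A) (m : ℕ) : Submodule k A := I.restrictScalars k ⊓ 𝒜 m

variable {𝒜}

lemma idealPiece_sup_span_le {I : Ideal A} (hI : I.IsHomogeneous 𝒜) {a : A} {e : ℕ}
    (ha : a ∈ 𝒜 e) (m : ℕ) :
    idealPiece 𝒜 (I ⊔ Ideal.span {a}) m ≤
      idealPiece 𝒜 I m ⊔
        (if e ≤ m then (𝒜 (m - e)).map (LinearMap.mulLeft k a) else ⊥) := by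
  rintro x ⟨hx, hxm⟩
  simp only [Submodule.coe_restrictScalars, SetLike.mem_coe] at hx hxm
  obtain ⟨i, hi, y, hy, rfl⟩ := Submodule.mem_sup.1 hx
  obtain ⟨c, rfl⟩ := Ideal.mem_span_singleton.1 hy
  have hsplit : (i + a * c : A) = (DirectSum.decompose 𝒜 i m : A)
      + (DirectSum.decompose 𝒜 (a * c) m : A) := by
    conv_lhs => rw [← DirectSum.decompose_of_mem_same 𝒜 hxm]
    rw [DirectSum.decompose_add]; rfl
  rw [hsplit]
  refine Submodule.add_mem_sup ⟨hI m hi, SetLike.coe_mem _⟩ ?_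
  split_ifs with h
  · rw [DirectSum.coe_decompose_mul_of_left_mem_of_le 𝒜 ha h]
    exact Submodule.mem_map_of_mem (SetLike.coe_mem _)
  · rw [DirectSum.coe_decompose_mul_of_left_mem_of_not_le 𝒜 ha h]
    exact Submodule.zero_mem _

lemma isHomogeneous_colon_singleton {I : Ideal A} (hI : I.IsHomogeneous 𝒜) {a : A} {e : ℕ}
    (ha : a ∈ 𝒜 e) : (I.colon {a}).IsHomogeneous 𝒜 := by
  intro i r hr
  rw [Submodule.mem_colon_singleton, smul_eq_mul] at hr ⊢
  have := hI (i + e) hr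
  rwa [DirectSum.coe_decompose_mul_add_of_right_mem 𝒜 ha] at this

theorem exists_hilbert_bound [IsNoetherianRing A] (h0 : 𝒜 0 ≤ Submodule.span k {1}) (I : Ideal A) :
    I.IsHomogeneous 𝒜 → ∀ r : ℕ, ringKrullDim (A ⧸ I) ≤ r →
      ∃ h : ℕ → ℕ, HasGrowth h r ∧ ∀ m, CoveredBy (idealPiece 𝒜 I m) (𝒜 m) (h m) := by
  induction I using WellFoundedGT.induction with
  | _ I ih =>
  intro hI r hr
  by_cases hprime : I.IsPrime
  · by_cases hall : ∀ e, 0 < e → ∀ a ∈ 𝒜 e, a ∈ I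
    · refine ⟨_, hasGrowth_unit r, fun m => ?_⟩
      split_ifs with hm
      · subst hm
        exact ⟨{1}, by simp, by simpa using h0.trans le_sup_right⟩
      · exact CoveredBy.of_le (le_inf (hall m (Nat.pos_of_ne_zero hm)) le_rfl) _
    · push Not at hall
      obtain ⟨e, he, a, ha, haI⟩ := hall
      have hlt : I < I ⊔ Ideal.span {a} := by
        refine lt_of_le_of_ne le_sup_left fun h => haI ?_
        rw [h]
        exact Ideal.mem_sup_right (Ideal.mem_span_singleton_self a)
      have hhom : (I ⊔ Ideal.span {a}).IsHomogeneous 𝒜 :=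
        hI.sup (Ideal.homogeneous_span 𝒜 _ (by rintro x rfl; exact ⟨e, ha⟩))
      have hdim : ringKrullDim (A ⧸ (I ⊔ Ideal.span {a})) + 1 ≤ r := by
        refine le_trans ?_ hr
        have hnz : Ideal.Quotient.mk I a ∈ nonZeroDivisors (A ⧸ I) := by
          rw [mem_nonZeroDivisors_iff_ne_zero]
          rwa [Ne, Ideal.Quotient.eq_zero_iff_mem]
        refine le_trans ?_ (ringKrullDim_quotient_succ_le_of_nonZeroDivisor hnz)
        have e1 := DoubleQuot.quotQuotEquivQuotSup I (Ideal.span {a})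
        rw [Ideal.map_span, Set.image_singleton] at e1
        rw [ringKrullDim_eq_of_ringEquiv e1]
      cases r with
      | zero =>
        exfalso
        have hne : I ⊔ Ideal.span {a} ≠ ⊤ := by
          intro htop
          have h1 : (1 : A) ∈ idealPiece 𝒜 (I ⊔ Ideal.span {a}) 0 := by
            refine ⟨?_, SetLike.GradedOne.one_mem⟩
            rw [htop]; trivial
          have := idealPiece_sup_span_le hI ha 0 h1
          rw [if_neg (by omega), sup_bot_eq] at this
          exact hprime.ne_top ((Ideal.eq_top_iff_one I).2 this.1)
        have : Nontrivial (A ⧸ (I ⊔ Ideal.span {a})) := Ideal.Quotient.nontrivial_iff.2 hne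
        have h0 := ringKrullDim_nonneg_of_nontrivial (R := A ⧸ (I ⊔ Ideal.span {a}))
        have h1 : (0 : WithBot ℕ∞) + 1 ≤ ((0 : ℕ) : WithBot ℕ∞) :=
          (add_le_add_left h0 1).trans hdim
        norm_num at h1
      | succ r =>
        obtain ⟨h', hg, hc⟩ := ih _ hlt hhom r (le_of_add_one_le_natCast_succ hdim)
        refine ⟨_, hg.sum, fun m => ?_⟩
        induction m using Nat.strong_induction_on with
        | _ m ihm =>
        have h1 := hc m
        rw [Finset.sum_range_succ]
        refine CoveredBy.trans (CoveredBy.mono ?_ le_rfl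
          (idealPiece_sup_span_le hI ha m) le_rfl) h1
        split_ifs with hem
        · have h2 := (ihm (m - e) (by omega)).map (LinearMap.mulLeft k a)
          have h3 : CoveredBy (idealPiece 𝒜 I m) ((𝒜 (m - e)).map (LinearMap.mulLeft k a))
              (∑ j ∈ Finset.range m, h' j) := by
            refine h2.mono ?_ le_rfl ?_
            · rintro _ ⟨x, ⟨hx, hx'⟩, rfl⟩
              refine ⟨I.mul_mem_left a hx, ?_⟩
              have := SetLike.GradedMul.mul_mem ha hx'
              rwa [Nat.add_sub_cancel' hem] at this
            · exact Finset.sum_le_sum_of_subset (Finset.range_mono (by omega))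
          simpa using (CoveredBy.of_le le_rfl 0).sup h3
        · exact CoveredBy.of_le (by simp) _
  · by_cases htop : I = ⊤
    · refine ⟨_, hasGrowth_zero r, fun m => CoveredBy.of_le ?_ _⟩
      intro x hx
      exact ⟨by rw [htop]; trivial, hx⟩
    · have : ¬ ∀ {x y : A}, SetLike.IsHomogeneousElem 𝒜 x → SetLike.IsHomogeneousElem 𝒜 y →
          x * y ∈ I → x ∈ I ∨ y ∈ I := fun h =>
        hprime (hI.isPrime_of_homogeneous_mem_or_mem htop h)
      push Not at this
      obtain ⟨a, b, ⟨e, ha⟩, -, hab, haI, hbI⟩ := this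
      have hlt : I < I ⊔ Ideal.span {a} := by
        refine lt_of_le_of_ne le_sup_left fun h => haI ?_
        rw [h]
        exact Ideal.mem_sup_right (Ideal.mem_span_singleton_self a)
      have hhom : (I ⊔ Ideal.span {a}).IsHomogeneous 𝒜 :=
        hI.sup (Ideal.homogeneous_span 𝒜 _ (by rintro x rfl; exact ⟨e, ha⟩))
      have hle' : I ≤ I.colon {a} := fun x hx => by
        rw [Submodule.mem_colon_singleton]
        exact I.mul_mem_right a hx
      have hlt' : I < I.colon {a} := by
        refine lt_of_le_of_ne hle' fun h => hbI ?_
        rw [h, Submodule.mem_colon_singleton, smul_eq_mul, mul_comm]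
        exact hab
      have hdim : ∀ I' : Ideal A, I ≤ I' → ringKrullDim (A ⧸ I') ≤ r := fun I' hle =>
        (ringKrullDim_le_of_surjective (Ideal.Quotient.factor hle)
          (Ideal.Quotient.factor_surjective hle)).trans hr
      obtain ⟨h₁, hg₁, hc₁⟩ := ih _ hlt hhom r (hdim _ hlt.le)
      obtain ⟨h₂, hg₂, hc₂⟩ := ih _ hlt' (isHomogeneous_colon_singleton hI ha) r (hdim _ hle')
      refine ⟨_, (hg₂.shift e).add hg₁, fun m => ?_⟩
      refine CoveredBy.trans (CoveredBy.mono ?_ le_rfl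
          (idealPiece_sup_span_le hI ha m) le_rfl) (hc₁ m)
      split_ifs with hem
      · have h2 := (hc₂ (m - e)).map (LinearMap.mulLeft k a)
        have h3 : CoveredBy (idealPiece 𝒜 I m) ((𝒜 (m - e)).map (LinearMap.mulLeft k a))
            (h₂ (m - e)) := by
          refine h2.mono ?_ le_rfl le_rfl
          rintro _ ⟨x, ⟨hx, hx'⟩, rfl⟩
          refine ⟨?_, ?_⟩
          · simp only [Submodule.coe_restrictScalars, SetLike.mem_coe,
              Submodule.mem_colon_singleton, smul_eq_mul] at hx
            rw [mul_comm] at hx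
            exact hx
          · have := SetLike.GradedMul.mul_mem ha hx'
            rwa [Nat.add_sub_cancel' hem] at this
        simpa using (CoveredBy.of_le le_rfl 0).sup h3
      · exact CoveredBy.of_le (by simp) _

variable [IsNoetherianRing A] (h0 : 𝒜 0 ≤ Submodule.span k {1})
include h0

lemma exists_piece_bound {d : ℕ} (hd : ringKrullDim A ≤ (d + 1 : ℕ)) :
    ∃ C, ∀ m, FiniteDimensional k (𝒜 m) ∧ Module.finrank k (𝒜 m) ≤ C * (m + 1) ^ d := by
  obtain ⟨h, ⟨C, hC⟩, hc⟩ := exists_hilbert_bound h0 (⊥ : Ideal A) (Ideal.IsHomogeneous.bot 𝒜)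
    (d + 1) (by
      rwa [ringKrullDim_eq_of_ringEquiv (RingEquiv.quotientBot A)])
  have hbot : ∀ m, idealPiece 𝒜 (⊥ : Ideal A) m = ⊥ := fun m => by
    simp [idealPiece]
  refine ⟨C, fun m => ?_⟩
  have := hc m
  rw [hbot] at this
  refine ⟨this.finiteDimensional, this.finrank_le.trans ?_⟩
  simpa using hC m

lemma exists_quotient_bound [IsDomain A] {d : ℕ} (hd : ringKrullDim A ≤ (d + 2 : ℕ)) {a : A} {e : ℕ}
    (ha : a ∈ 𝒜 e) (ha0 : a ≠ 0) :
    ∃ C, ∀ m, CoveredBy (idealPiece 𝒜 (Ideal.span {a}) m) (𝒜 m) (C * (m + 1) ^ d) := by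
  obtain ⟨h, ⟨C, hC⟩, hc⟩ := exists_hilbert_bound h0 (Ideal.span {a})
    (Ideal.homogeneous_span 𝒜 _ (by rintro x rfl; exact ⟨e, ha⟩)) (d + 1) (le_of_add_one_le_natCast_succ
      ((ringKrullDim_quotient_succ_le_of_nonZeroDivisor
        (mem_nonZeroDivisors_of_ne_zero ha0)).trans hd))
  exact ⟨C, fun m => (hc m).mono le_rfl le_rfl (hC m)⟩

end Hilbert

section Pieces

variable {k A : Type*} [Field k] [CommRing A] [Algebra k A] (𝒜 : ℕ → Submodule k A)

/-- The graded piece `𝒜 i` with `c * i + e = z`, or `⊥` if there is no such `i`. -/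
def scaledPiece (c : ℕ) (e z : ℤ) : Submodule k A :=
  ⨆ (i : ℕ) (_ : (c : ℤ) * i + e = z), 𝒜 i

/-- The grading extended by zero to integral degrees. -/
def zpiece (z : ℤ) : Submodule k A := scaledPiece 𝒜 1 0 z

variable {𝒜}

lemma scaledPiece_eq {c : ℕ} (hc : 0 < c) {e z : ℤ} {i : ℕ} (h : (c : ℤ) * i + e = z) :
    scaledPiece 𝒜 c e z = 𝒜 i := by
  apply le_antisymm
  · refine iSup₂_le fun j hj => ?_
    have h1 : (c : ℤ) * j = c * i := by linarith
    have h2 : (j : ℤ) = i := mul_left_cancel₀ (by positivity) h1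
    rw [Nat.cast_injective h2]
  · exact le_iSup₂_of_le i h le_rfl

lemma scaledPiece_eq_bot {c : ℕ} {e z : ℤ} (h : ∀ i : ℕ, (c : ℤ) * i + e ≠ z) :
    scaledPiece 𝒜 c e z = ⊥ := by
  rw [eq_bot_iff]
  exact iSup₂_le fun i hi => absurd hi (h i)

lemma le_scaledPiece {c : ℕ} {e z : ℤ} {i : ℕ} (h : (c : ℤ) * i + e = z) :
    𝒜 i ≤ scaledPiece 𝒜 c e z := le_iSup₂_of_le i h le_rfl

lemma zpiece_natCast (n : ℕ) : zpiece 𝒜 n = 𝒜 n := scaledPiece_eq one_pos (by simp)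

lemma zpiece_of_neg {z : ℤ} (hz : z < 0) : zpiece 𝒜 z = ⊥ :=
  scaledPiece_eq_bot fun i => by push_cast; omega

lemma scaledPiece_one (e z : ℤ) : scaledPiece 𝒜 1 e z = zpiece 𝒜 (z - e) := by
  rcases lt_or_ge (z - e) 0 with h | h
  · rw [zpiece_of_neg h, scaledPiece_eq_bot]
    intro i; push_cast; omega
  · obtain ⟨n, hn⟩ := Int.eq_ofNat_of_zero_le h
    rw [hn, zpiece_natCast, scaledPiece_eq one_pos]
    push_cast; omega

lemma scaledPiece_eq_zpiece {c : ℕ} (hc : 0 < c) {e z w : ℤ} (h : (c : ℤ) * w + e = z) :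
    scaledPiece 𝒜 c e z = zpiece 𝒜 w := by
  by_cases hw : 0 ≤ w
  · lift w to ℕ using hw
    rw [scaledPiece_eq hc h, zpiece_natCast]
  · rw [zpiece_of_neg (not_le.1 hw), scaledPiece_eq_bot]
    rintro i hi
    have h1 : (c : ℤ) * i = c * w := by linarith
    have h2 : (i : ℤ) = w := mul_left_cancel₀ (by positivity) h1
    omega

lemma finiteDimensional_scaledPiece [∀ m, FiniteDimensional k (𝒜 m)] {c : ℕ} (hc : 0 < c)
    (e z : ℤ) : FiniteDimensional k (scaledPiece 𝒜 c e z) := by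
  by_cases h : ∃ i : ℕ, (c : ℤ) * i + e = z
  · obtain ⟨i, hi⟩ := h
    rw [scaledPiece_eq hc hi]
    infer_instance
  · push Not at h
    rw [scaledPiece_eq_bot h]
    infer_instance

/-- Length of `V / (J ∩ V)`. -/
def relLen (J : Ideal A) (V : Submodule k A) : ℤ :=
  (Module.finrank k V : ℤ) - Module.finrank k ↥(J.restrictScalars k ⊓ V)

variable [GradedAlgebra 𝒜]

variable (𝒜) in
/-- Projection to the degree-`z` part. -/
def zproj (z : ℤ) : A →+ A :=
  if 0 ≤ z then (GradedRing.proj 𝒜 z.toNat) else 0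

lemma zproj_natCast (n : ℕ) (a : A) : zproj 𝒜 n a = DirectSum.decompose 𝒜 a n := by
  unfold zproj
  rw [if_pos (by omega)]
  rfl

lemma zproj_of_mem {z : ℤ} {a : A} (ha : a ∈ zpiece 𝒜 z) : zproj 𝒜 z a = a := by
  by_cases h : 0 ≤ z
  · lift z to ℕ using h
    rw [zpiece_natCast] at ha
    rw [zproj_natCast, DirectSum.decompose_of_mem_same 𝒜 ha]
  · rw [zpiece_of_neg (not_le.1 h), Submodule.mem_bot] at ha
    rw [ha, map_zero]

lemma zproj_of_mem_ne {z : ℤ} {i : ℕ} {a : A} (ha : a ∈ 𝒜 i) (hz : (i : ℤ) ≠ z) :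
    zproj 𝒜 z a = 0 := by
  unfold zproj
  split_ifs with h
  · lift z to ℕ using h
    exact DirectSum.decompose_of_mem_ne 𝒜 ha (by simpa using hz)
  · rfl

end Pieces

section Core

variable {k A B : Type*} [Field k] [CommRing A] [Algebra k A] [CommRing B] [Algebra k B]

/-- An injective ring homomorphism which is semilinear over an automorphism of the base field and
multiplies degrees by `c`. -/
structure IsScaledGraded (𝒜 : ℕ → Submodule k A) (ℬ : ℕ → Submodule k B) (σ : k →+* k) (c : ℕ)
    (ψ : A →+* B) : Prop where
  pos : 0 < c
  injective : Function.Injective ψ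
  map_smul : ∀ (l : k) (a : A), ψ (l • a) = σ l • ψ a
  map_mem : ∀ (i : ℕ), ∀ a ∈ 𝒜 i, ψ a ∈ ℬ (c * i)

variable {𝒜 : ℕ → Submodule k A} {ℬ : ℕ → Submodule k B} {σ : k →+* k} {c : ℕ} {ψ : A →+* B}

lemma IsScaledGraded.id (𝒜 : ℕ → Submodule k A) :
    IsScaledGraded 𝒜 𝒜 (RingHom.id k) 1 (RingHom.id A) :=
  ⟨one_pos, Function.injective_id, fun _ _ => rfl, fun i a ha => by simpa using ha⟩

namespace IsScaledGraded

/-- The semilinear map `a ↦ ∑ t, ψ (a t) * b t`. -/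
def comb (hψ : IsScaledGraded 𝒜 ℬ σ c ψ) {ι : Type*} [Fintype ι] (b : ι → B) :
    (ι → A) →ₛₗ[σ] B where
  toFun a := ∑ t, ψ (a t) * b t
  map_add' a a' := by simp [add_mul, Finset.sum_add_distrib]
  map_smul' l a := by simp [hψ.map_smul, Finset.smul_sum]

/-- The semilinear map `a ↦ ψ a * u`. -/
def mulMap (hψ : IsScaledGraded 𝒜 ℬ σ c ψ) (u : B) : A →ₛₗ[σ] B where
  toFun a := ψ a * u
  map_add' a a' := by simp [add_mul]
  map_smul' l a := by simp [hψ.map_smul]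

lemma comb_apply (hψ : IsScaledGraded 𝒜 ℬ σ c ψ) {ι : Type*} [Fintype ι] (b : ι → B) (a : ι → A) :
    hψ.comb b a = ∑ t, ψ (a t) * b t := rfl

lemma mulMap_apply (hψ : IsScaledGraded 𝒜 ℬ σ c ψ) (u : B) (a : A) :
    hψ.mulMap u a = ψ a * u := rfl

variable [GradedAlgebra 𝒜] [GradedAlgebra ℬ]

lemma mul_mem_zpiece (hψ : IsScaledGraded 𝒜 ℬ σ c ψ) {u : B} {e : ℕ} (hu : u ∈ ℬ e) {z : ℤ}
    {a : A} (ha : a ∈ scaledPiece 𝒜 c e z) : ψ a * u ∈ zpiece ℬ z := by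
  by_cases h : ∃ i : ℕ, (c : ℤ) * i + e = z
  · obtain ⟨i, rfl⟩ := h
    rw [scaledPiece_eq hψ.pos rfl] at ha
    have := SetLike.GradedMul.mul_mem (hψ.map_mem i a ha) hu
    rw [← zpiece_natCast (𝒜 := ℬ)] at this
    exact_mod_cast this
  · push Not at h
    rw [scaledPiece_eq_bot h, Submodule.mem_bot] at ha
    rw [ha, map_zero, zero_mul]
    exact Submodule.zero_mem _

lemma exists_zproj (hψ : IsScaledGraded 𝒜 ℬ σ c ψ) {u : B} {e : ℕ} (hu : u ∈ ℬ e) (z : ℤ)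
    (a : A) : ∃ a' ∈ scaledPiece 𝒜 c e z, zproj ℬ z (ψ a * u) = ψ a' * u := by
  induction a using DirectSum.Decomposition.inductionOn 𝒜 with
  | zero => exact ⟨0, Submodule.zero_mem _, by simp⟩
  | @homogeneous i m =>
    by_cases h : (c : ℤ) * i + e = z
    · refine ⟨m, le_scaledPiece h m.2, ?_⟩
      exact zproj_of_mem (hψ.mul_mem_zpiece hu (le_scaledPiece h m.2))
    · refine ⟨0, Submodule.zero_mem _, ?_⟩
      rw [map_zero, zero_mul]
      exact zproj_of_mem_ne (SetLike.GradedMul.mul_mem (hψ.map_mem i m m.2) hu)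
        (by push_cast; exact h)
  | add m m' h h' =>
    obtain ⟨x, hx, hx'⟩ := h
    obtain ⟨y, hy, hy'⟩ := h'
    exact ⟨x + y, Submodule.add_mem _ hx hy, by simp [add_mul, hx', hy']⟩

variable {ι : Type*} [Fintype ι] {b : ι → B} {e : ι → ℕ}

lemma exists_zproj_comb (hψ : IsScaledGraded 𝒜 ℬ σ c ψ) (hb : ∀ t, b t ∈ ℬ (e t)) (z : ℤ)
    (a : ι → A) : ∃ a' : ι → A, (∀ t, a' t ∈ scaledPiece 𝒜 c (e t) z) ∧
      zproj ℬ z (hψ.comb b a) = hψ.comb b a' := by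
  choose a' ha' h using fun t => hψ.exists_zproj (hb t) z (a t)
  exact ⟨a', ha', by simp [comb_apply, h]⟩

/-- The degree `z` part of the image of a free graded module. -/
def freePiece (hψ : IsScaledGraded 𝒜 ℬ σ c ψ) [RingHomSurjective σ] (b : ι → B)
    (V : ι → Submodule k A) : Submodule k B :=
  (Submodule.pi Set.univ V).map (hψ.comb b)

lemma mem_freePiece (hψ : IsScaledGraded 𝒜 ℬ σ c ψ) [RingHomSurjective σ] {V : ι → Submodule k A}
    {x : B} : x ∈ hψ.freePiece b V ↔ ∃ a : ι → A, (∀ t, a t ∈ V t) ∧ hψ.comb b a = x := by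
  simp [freePiece, Submodule.mem_map, Submodule.mem_pi]

lemma finrank_freePiece (hψ : IsScaledGraded 𝒜 ℬ σ c ψ) [RingHomSurjective σ]
    (hind : Function.Injective (hψ.comb b)) (V : ι → Submodule k A)
    [∀ t, FiniteDimensional k (V t)] :
    Module.finrank k (hψ.freePiece b V) = ∑ t, Module.finrank k (V t) := by
  let f : (Π t, V t) →+ hψ.freePiece b V :=
    { toFun := fun a => ⟨hψ.comb b (fun t => a t), hψ.mem_freePiece.2 ⟨_, fun t => (a t).2, rfl⟩⟩
      map_zero' := Subtype.ext (map_zero (hψ.comb b))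
      map_add' := fun x y => Subtype.ext (map_add (hψ.comb b) _ _) }
  have hf : Function.Bijective f := by
    constructor
    · intro x y hxy
      have := hind (congrArg Subtype.val hxy)
      funext t
      exact Subtype.ext (congrFun this t)
    · rintro ⟨x, hx⟩
      obtain ⟨a, ha, rfl⟩ := hψ.mem_freePiece.1 hx
      exact ⟨fun t => ⟨a t, ha t⟩, rfl⟩
  have hσ : Function.Bijective σ := ⟨σ.injective, RingHomSurjective.is_surjective⟩
  have := lift_rank_eq_of_equiv_equiv (σ : k → k) (AddEquiv.ofBijective f hf) hσ
    (fun r m => Subtype.ext (map_smulₛₗ (hψ.comb b) r _))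
  have h2 := congrArg Cardinal.toNat this
  rw [Cardinal.toNat_lift, Cardinal.toNat_lift] at h2
  change Module.finrank k (Π t, V t) = Module.finrank k (hψ.freePiece b V) at h2
  rw [← h2, Module.finrank_pi_fintype]

lemma freePiece_le_zpiece (hψ : IsScaledGraded 𝒜 ℬ σ c ψ) [RingHomSurjective σ]
    (hb : ∀ t, b t ∈ ℬ (e t)) (z : ℤ) :
    hψ.freePiece b (fun t => scaledPiece 𝒜 c (e t) z) ≤ zpiece ℬ z := by
  intro x hx
  obtain ⟨a, ha, rfl⟩ := hψ.mem_freePiece.1 hx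
  exact Submodule.sum_mem _ fun t _ => hψ.mul_mem_zpiece (hb t) (ha t)

lemma coveredBy_freePiece (hψ : IsScaledGraded 𝒜 ℬ σ c ψ) [RingHomSurjective σ]
    (hb : ∀ t, b t ∈ ℬ (e t)) {κ : Type*} [Fintype κ] {y : κ → B} {f : κ → ℕ}
    (hy : ∀ s, y s ∈ ℬ (f s)) (hgen : ∀ x, ∃ a, x = hψ.comb y a) {h : A}
    (hspan : ∀ x, ∃ a, ψ h * x = hψ.comb b a) {C D : ℕ}
    (hC : ∀ m, CoveredBy (idealPiece 𝒜 (Ideal.span {h}) m) (𝒜 m) (C * (m + 1) ^ D)) (z : ℤ) :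
    CoveredBy (hψ.freePiece b (fun t => scaledPiece 𝒜 c (e t) z)) (zpiece ℬ z)
      (Fintype.card κ * C * (z.toNat + 1) ^ D) := by
  have key : ∀ s, CoveredBy (hψ.freePiece b (fun t => scaledPiece 𝒜 c (e t) z))
      ((scaledPiece 𝒜 c (f s) z).map (hψ.mulMap (y s))) (C * (z.toNat + 1) ^ D) := by
    intro s
    by_cases hs : ∃ i : ℕ, (c : ℤ) * i + f s = z
    · obtain ⟨i, hi⟩ := hs
      rw [scaledPiece_eq hψ.pos hi]
      refine ((hC i).map (hψ.mulMap (y s))).mono ?_ le_rfl ?_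
      · rintro _ ⟨x, ⟨hx, hxi⟩, rfl⟩
        obtain ⟨w, rfl⟩ := Ideal.mem_span_singleton.1 hx
        obtain ⟨a, ha⟩ := hspan (ψ w * y s)
        have h1 : hψ.mulMap (y s) (h * w) = hψ.comb b a := by
          rw [← ha, mulMap_apply, map_mul, mul_assoc]
        have h2 : hψ.mulMap (y s) (h * w) ∈ zpiece ℬ z :=
          hψ.mul_mem_zpiece (hy s) (le_scaledPiece hi hxi)
        obtain ⟨a', ha', h3⟩ := hψ.exists_zproj_comb hb z a
        rw [← zproj_of_mem h2, h1, h3]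
        exact hψ.mem_freePiece.2 ⟨a', ha', rfl⟩
      · refine Nat.mul_le_mul_left _ (Nat.pow_le_pow_left ?_ _)
        have : (i : ℤ) ≤ c * i := by
          have := hψ.pos
          nlinarith
        omega
    · push Not at hs
      rw [scaledPiece_eq_bot hs, Submodule.map_bot]
      exact CoveredBy.of_le bot_le _
  refine (CoveredBy.iSup key).mono le_rfl ?_ (by simp [mul_assoc])
  intro x hx
  obtain ⟨a, rfl⟩ := hgen x
  obtain ⟨a', ha', h3⟩ := hψ.exists_zproj_comb hy z a
  rw [← zproj_of_mem hx, h3, comb_apply]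
  exact Submodule.sum_mem _ fun s _ =>
    Submodule.mem_iSup_of_mem s (Submodule.mem_map_of_mem (f := hψ.mulMap (y s)) (ha' s))

lemma map_zpiece_le (hψ : IsScaledGraded 𝒜 ℬ σ c ψ) {τ : Type*} [Fintype τ]
    {g : τ → A} {α : τ → ℕ} (hg : ∀ i, g i ∈ 𝒜 (α i)) (z : ℤ) :
    ((Ideal.span (Set.range g)).map ψ).restrictScalars k ⊓ zpiece ℬ z ≤
      ⨆ i, (zpiece ℬ (z - (c * α i : ℕ))).map (LinearMap.mulLeft k (ψ (g i))) := by
  rintro x ⟨hx, hxz⟩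
  rw [Ideal.map_span, ← Set.range_comp] at hx
  obtain ⟨w, hw⟩ := (Submodule.mem_span_range_iff_exists_fun B).1 hx
  choose w' hw' h using fun i => (IsScaledGraded.id ℬ).exists_zproj
    (hψ.map_mem _ _ (hg i)) z (w i)
  have hx' : x = ∑ i, ψ (g i) * w' i := by
    rw [← zproj_of_mem hxz, ← hw, map_sum]
    refine Finset.sum_congr rfl fun i _ => ?_
    have := h i
    simp only [RingHom.id_apply] at this
    rw [smul_eq_mul, Function.comp_apply, this, mul_comm]
  rw [hx']
  refine Submodule.sum_mem _ fun i _ => Submodule.mem_iSup_of_mem i ?_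
  have := hw' i
  rw [scaledPiece_one] at this
  exact Submodule.mem_map_of_mem (f := LinearMap.mulLeft k (ψ (g i))) this

lemma coveredBy_map_freePiece (hψ : IsScaledGraded 𝒜 ℬ σ c ψ) [RingHomSurjective σ]
    {K D : ℕ}
    (hK : ∀ z, CoveredBy (hψ.freePiece b (fun t => scaledPiece 𝒜 c (e t) z)) (zpiece ℬ z)
      (K * (z.toNat + 1) ^ D)) {τ : Type*} [Fintype τ]
    {g : τ → A} {α : τ → ℕ} (hg : ∀ i, g i ∈ 𝒜 (α i)) (z : ℤ) :
    CoveredBy (hψ.freePiece b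
      (fun t => (Ideal.span (Set.range g)).restrictScalars k ⊓ scaledPiece 𝒜 c (e t) z))
      (((Ideal.span (Set.range g)).map ψ).restrictScalars k ⊓ zpiece ℬ z)
      (Fintype.card τ * K * (z.toNat + 1) ^ D) := by
  have key : ∀ i, CoveredBy (hψ.freePiece b
      (fun t => (Ideal.span (Set.range g)).restrictScalars k ⊓ scaledPiece 𝒜 c (e t) z))
      ((zpiece ℬ (z - (c * α i : ℕ))).map (LinearMap.mulLeft k (ψ (g i))))
      (K * (z.toNat + 1) ^ D) := by
    intro i
    refine ((hK _).map (LinearMap.mulLeft k (ψ (g i)))).mono ?_ le_rfl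
      (Nat.mul_le_mul_left _ (Nat.pow_le_pow_left (by omega) _))
    rintro _ ⟨x, hx, rfl⟩
    obtain ⟨a, ha, rfl⟩ := hψ.mem_freePiece.1 hx
    refine hψ.mem_freePiece.2 ⟨fun t => g i * a t, fun t => ⟨?_, ?_⟩, ?_⟩
    · exact Ideal.mul_mem_right _ _ (Ideal.subset_span ⟨i, rfl⟩)
    · have h1 := ha t
      by_cases hs : ∃ j : ℕ, (c : ℤ) * j + e t = z - (c * α i : ℕ)
      · obtain ⟨j, hj⟩ := hs
        rw [scaledPiece_eq hψ.pos hj] at h1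
        refine le_scaledPiece (i := α i + j) ?_ (SetLike.GradedMul.mul_mem (hg i) h1)
        push_cast at hj ⊢
        linarith
      · push Not at hs
        rw [scaledPiece_eq_bot hs, Submodule.mem_bot] at h1
        simp only [h1, mul_zero]
        exact Submodule.zero_mem _
    · simp only [comb_apply, map_mul, LinearMap.mulLeft_apply, Finset.mul_sum, mul_assoc]
  exact (CoveredBy.iSup key).mono le_rfl (hψ.map_zpiece_le hg z) (by simp [mul_assoc])

theorem abs_relLen_sub_le (hψ : IsScaledGraded 𝒜 ℬ σ c ψ) [RingHomSurjective σ]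
    [∀ m, FiniteDimensional k (𝒜 m)] [∀ m, FiniteDimensional k (ℬ m)]
    (hb : ∀ t, b t ∈ ℬ (e t)) (hind : Function.Injective (hψ.comb b))
    {K D : ℕ}
    (hK : ∀ z, CoveredBy (hψ.freePiece b (fun t => scaledPiece 𝒜 c (e t) z)) (zpiece ℬ z)
      (K * (z.toNat + 1) ^ D)) {τ : Type*} [Fintype τ]
    {g : τ → A} {α : τ → ℕ} (hg : ∀ i, g i ∈ 𝒜 (α i)) (z : ℤ) :
    |relLen ((Ideal.span (Set.range g)).map ψ) (zpiece ℬ z) -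
      ∑ t, relLen (Ideal.span (Set.range g)) (scaledPiece 𝒜 c (e t) z)| ≤
      ((Fintype.card τ + 1) * K : ℕ) * ((z.toNat + 1 : ℕ) : ℤ) ^ D := by
  have : ∀ t, FiniteDimensional k (scaledPiece 𝒜 c (e t) z) := fun t =>
    finiteDimensional_scaledPiece hψ.pos _ _
  have : FiniteDimensional k (zpiece ℬ z) :=
    finiteDimensional_scaledPiece one_pos _ _
  set J := Ideal.span (Set.range g) with hJ
  set F := hψ.freePiece b (fun t => scaledPiece 𝒜 c (e t) z) with hF
  set JF := hψ.freePiece b (fun t => J.restrictScalars k ⊓ scaledPiece 𝒜 c (e t) z) with hJF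
  have hFle : F ≤ zpiece ℬ z := hψ.freePiece_le_zpiece hb z
  have hJFle : JF ≤ (J.map ψ).restrictScalars k ⊓ zpiece ℬ z := by
    intro x hx
    obtain ⟨a, ha, rfl⟩ := hψ.mem_freePiece.1 hx
    refine ⟨?_, Submodule.sum_mem _ fun t _ => hψ.mul_mem_zpiece (hb t) (ha t).2⟩
    exact Submodule.sum_mem _ fun t _ =>
      Ideal.mul_mem_right _ _ (Ideal.mem_map_of_mem ψ (ha t).1)
  have : FiniteDimensional k F := Submodule.finiteDimensional_of_le hFle
  have : FiniteDimensional k JF := Submodule.finiteDimensional_of_le (hJFle.trans inf_le_right)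
  have h1 := (hK z).finrank_le
  have h2 := (hψ.coveredBy_map_freePiece hK hg z).finrank_le
  have h3 := Submodule.finrank_mono hFle
  have h4 := Submodule.finrank_mono hJFle
  have h5 := hψ.finrank_freePiece hind (fun t => scaledPiece 𝒜 c (e t) z)
  have h6 := hψ.finrank_freePiece hind
    (fun t => J.restrictScalars k ⊓ scaledPiece 𝒜 c (e t) z)
  rw [← hF] at h1 h5
  rw [← hJF] at h2 h6
  unfold relLen
  rw [Finset.sum_sub_distrib, ← Nat.cast_sum, ← Nat.cast_sum, ← h5, ← h6]
  zify at h1 h2 h3 h4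
  have h7 : (((Fintype.card τ + 1) * K : ℕ) : ℤ) * ((z.toNat + 1 : ℕ) : ℤ) ^ D =
      Fintype.card τ * K * ((z.toNat : ℤ) + 1) ^ D + K * ((z.toNat : ℤ) + 1) ^ D := by
    push_cast; ring
  have h8 : 0 ≤ (Fintype.card τ * K : ℤ) * ((z.toNat : ℤ) + 1) ^ D := by positivity
  have h9 : 0 ≤ (K : ℤ) * ((z.toNat : ℤ) + 1) ^ D := by positivity
  rw [h7, abs_le]
  constructor <;> linarith

end IsScaledGraded

end Core

section Basis

variable {k A B : Type*} [Field k] [CommRing A] [Algebra k A] [CommRing B] [Algebra k B]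
  {𝒜 : ℕ → Submodule k A} {ℬ : ℕ → Submodule k B} {σ : k →+* k} {c : ℕ} {ψ : A →+* B}
  [GradedAlgebra 𝒜] [GradedAlgebra ℬ]

namespace IsScaledGraded

lemma zproj_mul (hψ : IsScaledGraded 𝒜 ℬ σ c ψ) {u : B} {e : ℕ} (hu : u ∈ ℬ e) (m : ℕ)
    (a : A) : zproj ℬ ((c * m + e : ℕ) : ℤ) (ψ a * u) = ψ (DirectSum.decompose 𝒜 a m) * u := by
  induction a using DirectSum.Decomposition.inductionOn 𝒜 with
  | zero => simp
  | @homogeneous i x =>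
    have hx := SetLike.GradedMul.mul_mem (hψ.map_mem i x x.2) hu
    by_cases h : i = m
    · subst h
      rw [DirectSum.decompose_of_mem_same 𝒜 x.2]
      exact zproj_of_mem (by rwa [zpiece_natCast])
    · rw [DirectSum.decompose_of_mem_ne 𝒜 x.2 h, map_zero, zero_mul]
      refine zproj_of_mem_ne hx fun h' => h ?_
      have h'' : c * i + e = c * m + e := by exact_mod_cast h'
      exact Nat.eq_of_mul_eq_mul_left hψ.pos (by omega)
  | add x y hx hy =>
    rw [map_add, add_mul, map_add, hx, hy]
    simp [add_mul]

lemma exists_homogeneous_multiplier (hψ : IsScaledGraded 𝒜 ℬ σ c ψ) {ι : Type*} [Fintype ι]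
    {b : ι → B} {e : ι → ℕ} (hb : ∀ t, b t ∈ ℬ (e t)) {u : B} {f : ℕ} (hu : u ∈ ℬ f) {a : A}
    (ha : a ≠ 0) (h : ∃ w, ψ a * u = hψ.comb b w) :
    ∃ (a' : A) (η : ℕ), a' ∈ 𝒜 η ∧ a' ≠ 0 ∧ ∃ w, ψ a' * u = hψ.comb b w := by
  obtain ⟨w, hw⟩ := h
  obtain ⟨m, hm⟩ : ∃ m, (DirectSum.decompose 𝒜 a m : A) ≠ 0 := by
    by_contra! hcon
    refine ha ((DirectSum.decompose 𝒜).injective ?_)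
    ext m
    simp [hcon m]
  obtain ⟨w', -, hw'⟩ := hψ.exists_zproj_comb hb ((c * m + f : ℕ) : ℤ) w
  exact ⟨_, m, SetLike.coe_mem _, hm, w', by rw [← hψ.zproj_mul hu, hw, hw']⟩

lemma exists_homogeneous_generators (hψ : IsScaledGraded 𝒜 ℬ σ c ψ) [Module A B]
    [Module.Finite A B] (hsmul : ∀ (a : A) (x : B), a • x = ψ a * x) :
    ∃ (m : ℕ) (y : Fin m → B) (f : Fin m → ℕ), (∀ s, y s ∈ ℬ (f s)) ∧
      ∀ x, ∃ a, x = hψ.comb y a := by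
  classical
  obtain ⟨G, hG⟩ := Module.Finite.fg_top (R := A) (M := B)
  let G' : Finset B := G.biUnion fun g =>
    (DirectSum.decompose ℬ g).support.image fun i => (DirectSum.decompose ℬ g i : B)
  have hG' : ∀ x ∈ G', ∃ i, x ∈ ℬ i := by
    intro x hx
    simp only [G', Finset.mem_biUnion, Finset.mem_image] at hx
    obtain ⟨g, -, i, -, rfl⟩ := hx
    exact ⟨i, SetLike.coe_mem _⟩
  have hspan : Submodule.span A (G' : Set B) = ⊤ := by
    rw [eq_top_iff, ← hG, Submodule.span_le]
    intro g hg
    rw [SetLike.mem_coe, ← DirectSum.sum_support_decompose ℬ g]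
    refine Submodule.sum_mem _ fun i hi => Submodule.subset_span ?_
    simp only [G', Finset.mem_coe, Finset.mem_biUnion, Finset.mem_image]
    exact ⟨g, hg, i, hi, rfl⟩
  let eq := G'.equivFin
  choose f hf using fun x : G' => hG' x x.2
  refine ⟨G'.card, fun s => (eq.symm s : B), fun s => f (eq.symm s), fun s => hf _, fun x => ?_⟩
  have hx : x ∈ Submodule.span A (Set.range fun s => (eq.symm s : B)) := by
    have : Set.range (fun s => (eq.symm s : B)) = (G' : Set B) := by
      ext z
      constructor
      · rintro ⟨s, rfl⟩; exact (eq.symm s).2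
      · intro hz; exact ⟨eq ⟨z, hz⟩, by simp⟩
    rw [this, hspan]; trivial
  obtain ⟨a, ha⟩ := (Submodule.mem_span_range_iff_exists_fun A).1 hx
  exact ⟨a, by rw [← ha, comb_apply]; simp [hsmul]⟩

lemma exists_homogeneous_basis (hψ : IsScaledGraded 𝒜 ℬ σ c ψ) [IsDomain A] [Module A B]
    [Module.Finite A B] (hsmul : ∀ (a : A) (x : B), a • x = ψ a * x) :
    ∃ (b : Fin (Module.finrank A B) → B) (e : Fin (Module.finrank A B) → ℕ),
      (∀ t, b t ∈ ℬ (e t)) ∧ Function.Injective (hψ.comb b) ∧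
      ∃ (h : A) (η : ℕ), h ∈ 𝒜 η ∧ h ≠ 0 ∧ ∀ x, ∃ a, ψ h * x = hψ.comb b a := by
  classical
  obtain ⟨m, y, f, hy, hgen⟩ := hψ.exists_homogeneous_generators hsmul
  obtain ⟨s, hs, hmax⟩ := exists_maximal_linearIndepOn A y
  have hspan_iff : ∀ x : B, x ∈ Submodule.span A (y '' s) ↔
      ∃ w, x = hψ.comb (fun t : s => y t) w := by
    intro x
    rw [Set.image_eq_range, Submodule.mem_span_range_iff_exists_fun]
    simp only [comb_apply, hsmul, eq_comm]
  have hmult : ∀ i, ∃ (a' : A) (η : ℕ), a' ∈ 𝒜 η ∧ a' ≠ 0 ∧ a' • y i ∈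
      Submodule.span A (y '' s) := by
    intro i
    by_cases hi : i ∈ s
    · exact ⟨1, 0, SetLike.GradedOne.one_mem, one_ne_zero, by
        rw [one_smul]; exact Submodule.subset_span ⟨i, hi, rfl⟩⟩
    · obtain ⟨a, ha, ha'⟩ := hmax i hi
      rw [hspan_iff, hsmul] at ha'
      obtain ⟨a', η, h1, h2, h3⟩ := hψ.exists_homogeneous_multiplier (fun t : s => hy t)
        (hy i) ha ha'
      exact ⟨a', η, h1, h2, by rw [hspan_iff, hsmul]; exact h3⟩
  choose a' η ha' hne hmem using hmult
  have hh : ∀ x : B, (∏ i, a' i) • x ∈ Submodule.span A (y '' s) := by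
    intro x
    obtain ⟨w, rfl⟩ := hgen x
    rw [comb_apply, Finset.smul_sum]
    refine Submodule.sum_mem _ fun i _ => ?_
    rw [← hsmul, smul_comm, ← Finset.prod_erase_mul _ _ (Finset.mem_univ i), mul_smul]
    exact Submodule.smul_mem _ _ (Submodule.smul_mem _ _ (hmem i))
  have hrank : Module.finrank A B = Fintype.card s := by
    have h1 := rank_quotient_add_rank_of_isDomain (Submodule.span A (y '' s))
    have h2 : Module.rank A (B ⧸ Submodule.span A (y '' s)) = 0 := by
      rw [rank_eq_zero_iff]
      intro x
      obtain ⟨x, rfl⟩ := Submodule.Quotient.mk_surjective _ x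
      refine ⟨∏ i, a' i, Finset.prod_ne_zero_iff.2 fun i _ => hne i, ?_⟩
      rw [← Submodule.Quotient.mk_smul, Submodule.Quotient.mk_eq_zero]
      exact hh x
    rw [h2, zero_add] at h1
    have h3 := finrank_span_eq_card (R := A) hs
    rw [← Set.image_eq_range] at h3
    rw [← h3]
    unfold Module.finrank
    rw [h1]
  have eq : Fin (Module.finrank A B) ≃ s := (finCongr hrank).trans (Fintype.equivFin s).symm
  refine ⟨fun t => y (eq t), fun t => f (eq t), fun t => hy _, ?_, ∏ i, a' i, ∑ i, η i,
    SetLike.prod_mem_graded _ _ _ (fun i _ => ha' i), Finset.prod_ne_zero_iff.2 fun i _ => hne i,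
    fun x => ?_⟩
  · rw [injective_iff_map_eq_zero]
    intro a ha
    have h1 := Fintype.linearIndependent_iff.1 (hs.comp eq eq.injective) a (by
      simpa [comb_apply, hsmul] using ha)
    exact funext h1
  · obtain ⟨w, hw⟩ := (hspan_iff _).1 (hh x)
    refine ⟨fun t => w (eq t), ?_⟩
    rw [← hsmul, hw, comb_apply, comb_apply]
    exact (eq.sum_comp (fun t => ψ (w t) * y t)).symm

end IsScaledGraded

end Basis

section Close

variable {X : Type*}

/-- The difference of the families `f` and `g` is `O(z ^ D)`, uniformly in the family. -/
def Close (D : ℕ) (f g : X → ℤ → ℤ) : Prop :=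
  ∃ C : ℕ, ∀ x z, |f x z - g x z| ≤ C * ((z.toNat + 1 : ℕ) : ℤ) ^ D

lemma toNat_add_one_pow_le {z z' : ℤ} {E : ℕ} (h : |z' - z| ≤ E) (D : ℕ) :
    (((z'.toNat + 1 : ℕ) : ℤ)) ^ D ≤ ((E + 1) ^ D : ℕ) * ((z.toNat + 1 : ℕ) : ℤ) ^ D := by
  have h1 : z'.toNat + 1 ≤ (E + 1) * (z.toNat + 1) := by
    rw [abs_le] at h
    have : z'.toNat ≤ z.toNat + E := by omega
    nlinarith
  have h2 := Nat.pow_le_pow_left h1 D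
  rw [mul_pow] at h2
  exact_mod_cast h2

namespace Close

variable {D : ℕ} {f g h : X → ℤ → ℤ}

lemma refl (f : X → ℤ → ℤ) : Close D f f := ⟨0, fun x z => by simp⟩

lemma symm (H : Close D f g) : Close D g f := by
  obtain ⟨C, hC⟩ := H
  exact ⟨C, fun x z => by rw [abs_sub_comm]; exact hC x z⟩

lemma trans (H : Close D f g) (H' : Close D g h) : Close D f h := by
  obtain ⟨C, hC⟩ := H
  obtain ⟨C', hC'⟩ := H'
  refine ⟨C + C', fun x z => ?_⟩
  have := abs_sub_le (f x z) (g x z) (h x z)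
  have h1 := hC x z
  have h2 := hC' x z
  push_cast at *
  linarith

lemma add {f' g' : X → ℤ → ℤ} (H : Close D f g) (H' : Close D f' g') :
    Close D (fun x z => f x z + f' x z) (fun x z => g x z + g' x z) := by
  obtain ⟨C, hC⟩ := H
  obtain ⟨C', hC'⟩ := H'
  refine ⟨C + C', fun x z => ?_⟩
  have := abs_add_le (f x z - g x z) (f' x z - g' x z)
  have h1 := hC x z
  have h2 := hC' x z
  rw [show f x z + f' x z - (g x z + g' x z) = f x z - g x z + (f' x z - g' x z) by ring]
  push_cast at *
  linarith

lemma sum {ι : Type*} (s : Finset ι) {f g : ι → X → ℤ → ℤ} (H : ∀ i ∈ s, Close D (f i) (g i)) :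
    Close D (fun x z => ∑ i ∈ s, f i x z) (fun x z => ∑ i ∈ s, g i x z) := by
  classical
  induction s using Finset.induction_on with
  | empty => exact ⟨0, fun x z => by simp⟩
  | insert a s ha ih =>
    simp only [Finset.sum_insert ha]
    exact (H a (by simp)).add (ih fun i hi => H i (by simp [hi]))

lemma shift (H : Close D f g) (e : ℤ) :
    Close D (fun x z => f x (z + e)) (fun x z => g x (z + e)) := by
  obtain ⟨C, hC⟩ := H
  refine ⟨C * (e.natAbs + 1) ^ D, fun x z => (hC x (z + e)).trans ?_⟩
  have := toNat_add_one_pow_le (z := z) (z' := z + e) (E := e.natAbs) (by simp) D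
  calc _ ≤ (C : ℤ) * (((e.natAbs + 1) ^ D : ℕ) * ((z.toNat + 1 : ℕ) : ℤ) ^ D) := by gcongr
    _ = _ := by push_cast; ring

end Close

/-- Sum of `m` consecutive values. -/
def window (m : ℕ) (L : ℤ → ℤ) (z : ℤ) : ℤ := ∑ i ∈ Finset.range m, L (z + i)

lemma window_mul (l m : ℕ) (L : ℤ → ℤ) (z : ℤ) :
    window (l * m) L z = ∑ s ∈ Finset.range l, window m L (z + (s * m : ℕ)) := by
  induction l with
  | zero => simp [window]
  | succ l ih =>
    rw [Finset.sum_range_succ, ← ih, add_mul, one_mul]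
    simp only [window]
    rw [Finset.sum_range_add]
    congr 1
    refine Finset.sum_congr rfl fun i _ => ?_
    push_cast
    rw [add_assoc]

lemma window_add_one_sub (m : ℕ) (L : ℤ → ℤ) (z : ℤ) :
    window m L (z + 1) - window m L z = L (z + m) - L z := by
  simp only [window]
  rw [← Finset.sum_sub_distrib]
  have := Finset.sum_range_sub (fun i : ℕ => L (z + i)) m
  simp only [Nat.cast_zero, add_zero] at this
  rw [← this]
  refine Finset.sum_congr rfl fun i _ => ?_
  push_cast
  rw [add_assoc, add_comm (1 : ℤ)]

/-- Windows of width `m` vary by `O(z ^ D)` under bounded shifts. -/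
def SlowWindow (D m : ℕ) (L : X → ℤ → ℤ) : Prop :=
  ∀ E : ℕ, ∃ C : ℕ, ∀ x z z', |z' - z| ≤ (E : ℤ) →
    |window m (L x) z' - window m (L x) z| ≤ C * ((z.toNat + 1 : ℕ) : ℤ) ^ D

/-- The shifts under which `L` changes by `O(z ^ D)`. -/
def closeShifts (D : ℕ) (L : X → ℤ → ℤ) : AddSubgroup ℤ where
  carrier := {e | Close D (fun x z => L x (z + e)) L}
  zero_mem' := by simpa using Close.refl L
  add_mem' {a b} ha hb := by
    have := (Close.shift ha b).trans hb
    simpa only [Set.mem_ofPred_eq, add_comm a b, ← add_assoc] using this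
  neg_mem' {a} ha := by
    have := (Close.shift ha (-a)).symm
    simpa [add_assoc] using this

lemma mem_closeShifts {D : ℕ} {L : X → ℤ → ℤ} {e : ℤ} :
    e ∈ closeShifts D L ↔ Close D (fun x z => L x (z + e)) L := Iff.rfl

lemma slowWindow_of_mem_closeShifts {D m : ℕ} {L : X → ℤ → ℤ}
    (h : (m : ℤ) ∈ closeShifts D L) : SlowWindow D m L := by
  have h1 : (1 : ℤ) ∈ closeShifts D (fun x => window m (L x)) := by
    obtain ⟨C, hC⟩ := h
    exact ⟨C, fun x z => by rw [window_add_one_sub]; exact hC x z⟩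
  have h2 : ∀ e : ℤ, e ∈ closeShifts D (fun x => window m (L x)) := fun e => by
    have := (closeShifts D (fun x => window m (L x))).zsmul_mem h1 e
    simpa using this
  intro E
  choose C hC using h2
  refine ⟨∑ e ∈ Finset.Icc (-(E : ℤ)) E, C e, fun x z z' hz => ?_⟩
  have h3 := hC (z' - z) x z
  simp only [add_sub_cancel] at h3
  refine h3.trans ?_
  have : C (z' - z) ≤ ∑ e ∈ Finset.Icc (-(E : ℤ)) E, C e :=
    Finset.single_le_sum (f := C) (fun _ _ => Nat.zero_le _) (Finset.mem_Icc.2 (abs_le.1 hz))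
  gcongr

lemma natCast_mem_addSubgroup (H : AddSubgroup ℤ) {P : ℕ → Prop} {m : ℕ}
    (hP : ∀ e, P e → (e : ℤ) ∈ H) (hm : ∀ c : ℕ, (∀ e, P e → c ∣ e) → c ∣ m) : (m : ℤ) ∈ H := by
  obtain ⟨a, ha⟩ := Int.subgroup_cyclic H
  rw [ha, AddSubgroup.mem_closure_singleton]
  have : a.natAbs ∣ m := hm _ fun e he => by
    have := hP e he
    rw [ha, AddSubgroup.mem_closure_singleton] at this
    obtain ⟨n, hn⟩ := this
    rw [← Int.natCast_dvd_natCast, Int.natAbs_dvd]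
    exact ⟨n, by rw [← hn]; simp [mul_comm]⟩
  rw [← Int.natCast_dvd_natCast, Int.natAbs_dvd] at this
  obtain ⟨n, hn⟩ := this
  exact ⟨n, by rw [hn]; simp [mul_comm]⟩

end Close

section Tuples

variable {k A B : Type*} [Field k] [CommRing A] [Algebra k A] [CommRing B] [Algebra k B]

lemma relLen_bot (J : Ideal A) : relLen J (⊥ : Submodule k A) = 0 := by
  simp [relLen]

lemma window_scaledPiece {𝒜 : ℕ → Submodule k A} {c : ℕ} (hc : 0 < c) (e : ℤ) (m : ℕ)
    (J : Ideal A) (z : ℤ) :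
    window (c * m) (fun z => relLen J (scaledPiece 𝒜 c e z)) z =
      window m (fun z => relLen J (zpiece 𝒜 z)) ((z - e + c - 1) / c) := by
  rw [mul_comm, window_mul]
  rw [window]
  refine Finset.sum_congr rfl fun s _ => ?_
  have hc' : (0 : ℤ) < c := by exact_mod_cast hc
  set w := (z - e + c - 1) / c with hw
  have h1 : c * w ≤ z - e + c - 1 := Int.mul_ediv_self_le hc'.ne'
  have h2 : z - e + c - 1 < c * w + c := Int.lt_mul_ediv_self_add hc'
  have h3 : ((c * w + e - z).toNat : ℤ) = c * w + e - z := Int.toNat_of_nonneg (by omega)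
  rw [window, Finset.sum_eq_single (c * w + e - z).toNat]
  · rw [scaledPiece_eq_zpiece hc (w := w + s)]
    rw [h3]; push_cast; ring
  · intro j hj hne
    rw [scaledPiece_eq_bot, relLen_bot]
    intro i hi
    rw [Finset.mem_range] at hj
    have h4 : (c : ℤ) * (i - s - w) = z + j - e - c * w := by
      push_cast at hi
      linear_combination hi
    have h5 : (i : ℤ) - s - w = 0 := by
      have hlt : (c : ℤ) * (i - s - w) < c * 1 := by omega
      have hgt : (c : ℤ) * (-1) < c * (i - s - w) := by omega
      have := lt_of_mul_lt_mul_left hlt hc'.le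
      have := lt_of_mul_lt_mul_left hgt hc'.le
      omega
    rw [h5] at h4
    omega
  · intro h
    rw [Finset.mem_range] at h
    omega

lemma abs_ceilDiv_sub_le {c : ℕ} (hc : 0 < c) (e : ℕ) (z : ℤ) :
    |(z - e + c - 1) / c - z / c| ≤ ((e + 2 : ℕ) : ℤ) := by
  have hc' : (0 : ℤ) < c := by exact_mod_cast hc
  have h1 : c * ((z - e + c - 1) / c) ≤ z - e + c - 1 := Int.mul_ediv_self_le hc'.ne'
  have h2 : z - e + c - 1 < c * ((z - e + c - 1) / c) + c := Int.lt_mul_ediv_self_add hc'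
  have h3 : c * (z / c) ≤ z := Int.mul_ediv_self_le hc'.ne'
  have h4 : z < c * (z / c) + c := Int.lt_mul_ediv_self_add hc'
  rw [abs_le]
  push_cast
  constructor <;> nlinarith

/-- Tuples of homogeneous elements. -/
structure HomTuple (𝒜 : ℕ → Submodule k A) (τ : Type*) where
  /-- The elements of the tuple. -/
  val : τ → A
  exists_mem : ∀ i, ∃ a, val i ∈ 𝒜 a

/-- The Hilbert function of the quotient by the ideal generated by a homogeneous tuple. -/
def tupleLen {𝒜 : ℕ → Submodule k A} {τ : Type*} (g : HomTuple 𝒜 τ) (z : ℤ) : ℤ :=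
  relLen (Ideal.span (Set.range g.val)) (zpiece 𝒜 z)

/-- The image of a homogeneous tuple. -/
def HomTuple.map {𝒜 : ℕ → Submodule k A} {ℬ : ℕ → Submodule k B} {σ : k →+* k} {c : ℕ}
    {ψ : A →+* B} (hψ : IsScaledGraded 𝒜 ℬ σ c ψ) {τ : Type*} (g : HomTuple 𝒜 τ) :
    HomTuple ℬ τ :=
  ⟨fun i => ψ (g.val i), fun i => (g.exists_mem i).elim fun _ ha => ⟨_, hψ.map_mem _ _ ha⟩⟩

lemma tupleLen_map {𝒜 : ℕ → Submodule k A} {ℬ : ℕ → Submodule k B} {σ : k →+* k} {c : ℕ}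
    {ψ : A →+* B} (hψ : IsScaledGraded 𝒜 ℬ σ c ψ) {τ : Type*} (g : HomTuple 𝒜 τ) (z : ℤ) :
    tupleLen (g.map hψ) z = relLen ((Ideal.span (Set.range g.val)).map ψ) (zpiece ℬ z) := by
  rw [Ideal.map_span, ← Set.range_comp]
  rfl

section Graded

variable {𝒜 : ℕ → Submodule k A} {ℬ : ℕ → Submodule k B} [GradedAlgebra 𝒜] [GradedAlgebra ℬ]
  [IsDomain A] [IsNoetherianRing A] {τ : Type*} [Fintype τ] {D : ℕ}

omit [IsNoetherianRing A] in
lemma close_tupleLen_shift [∀ m, FiniteDimensional k (𝒜 m)] {u : A} {e : ℕ} (hu : u ∈ 𝒜 e)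
    (hu0 : u ≠ 0) {C : ℕ}
    (hC : ∀ m, CoveredBy (idealPiece 𝒜 (Ideal.span {u}) m) (𝒜 m) (C * (m + 1) ^ D)) :
    (e : ℤ) ∈ closeShifts D (tupleLen (𝒜 := 𝒜) (τ := τ)) := by
  rw [← neg_mem_iff, mem_closeShifts]
  have hψ := IsScaledGraded.id 𝒜
  have h1 : ∀ t : Unit, (fun _ : Unit => u) t ∈ 𝒜 ((fun _ : Unit => e) t) := fun _ => hu
  have h2 := hψ.coveredBy_freePiece h1 (y := fun _ : Unit => (1 : A)) (f := fun _ => 0)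
    (fun _ => SetLike.GradedOne.one_mem)
    (fun x => ⟨fun _ => x, by simp [IsScaledGraded.comb_apply]⟩)
    (fun x => ⟨fun _ => x, by simp [IsScaledGraded.comb_apply, mul_comm]⟩) hC
  have hind : Function.Injective (hψ.comb (fun _ : Unit => u)) := by
    rw [injective_iff_map_eq_zero]
    intro a ha
    ext
    simpa [IsScaledGraded.comb_apply, hu0] using ha
  refine Close.symm ⟨(Fintype.card τ + 1) * (Fintype.card Unit * C), fun g z => ?_⟩
  choose α hα using g.exists_mem
  have h3 := hψ.abs_relLen_sub_le h1 hind h2 hα z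
  simpa [scaledPiece_one, Ideal.map_id, tupleLen, ← sub_eq_add_neg] using h3

lemma slowWindow_tupleLen (h0 : 𝒜 0 ≤ Submodule.span k {1}) {m₀ : ℕ}
    (hm : ∀ c : ℕ, (∀ m, 0 < m → 𝒜 m ≠ ⊥ → c ∣ m) → c ∣ m₀)
    (hd : ringKrullDim A ≤ (D + 2 : ℕ)) :
    SlowWindow D m₀ (tupleLen (𝒜 := 𝒜) (τ := τ)) := by
  obtain ⟨C, hC⟩ := exists_piece_bound h0 (d := D + 1) hd
  have : ∀ m, FiniteDimensional k (𝒜 m) := fun m => (hC m).1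
  refine slowWindow_of_mem_closeShifts (natCast_mem_addSubgroup _
    (P := fun m => 0 < m ∧ 𝒜 m ≠ ⊥) ?_ (by simpa using hm))
  rintro e ⟨-, he⟩
  obtain ⟨u, hu, hu0⟩ := Submodule.exists_mem_ne_zero_of_ne_bot he
  obtain ⟨C', hC'⟩ := exists_quotient_bound h0 hd hu hu0
  exact close_tupleLen_shift hu hu0 hC'

/-- Comparison of Hilbert functions along a module-finite map. -/
theorem exists_window_map_bound {σ : k →+* k} [RingHomSurjective σ] {c : ℕ} {ψ : A →+* B}
    (hψ : IsScaledGraded 𝒜 ℬ σ c ψ) [Module A B] [Module.Finite A B]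
    (hsmul : ∀ (a : A) (x : B), a • x = ψ a * x)
    (h0 : 𝒜 0 ≤ Submodule.span k {1}) [∀ m, FiniteDimensional k (ℬ m)]
    {m₀ : ℕ} (hm : ∀ c : ℕ, (∀ m, 0 < m → 𝒜 m ≠ ⊥ → c ∣ m) → c ∣ m₀)
    (hd : ringKrullDim A ≤ (D + 2 : ℕ)) :
    ∃ C : ℕ, ∀ (g : HomTuple 𝒜 τ) (z : ℤ), |window (c * m₀) (tupleLen (g.map hψ)) z -
      Module.finrank A B * window m₀ (tupleLen g) (z / c)| ≤ C * ((z.toNat + 1 : ℕ) : ℤ) ^ D := by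
  obtain ⟨C₀, hC₀⟩ := exists_piece_bound h0 (d := D + 1) hd
  have : ∀ m, FiniteDimensional k (𝒜 m) := fun m => (hC₀ m).1
  obtain ⟨b, e, hb, hind, h, η, hh, hh0, hspan⟩ := hψ.exists_homogeneous_basis hsmul
  obtain ⟨m, y, f, hy, hgen⟩ := hψ.exists_homogeneous_generators hsmul
  obtain ⟨C₁, hC₁⟩ := exists_quotient_bound h0 hd hh hh0
  have hK := hψ.coveredBy_freePiece hb hy hgen hspan hC₁
  have h1 : Close D (fun (g : HomTuple 𝒜 τ) z => tupleLen (g.map hψ) z)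
      (fun g z => ∑ t, relLen (Ideal.span (Set.range g.val)) (scaledPiece 𝒜 c (e t) z)) := by
    refine ⟨(Fintype.card τ + 1) * (Fintype.card (Fin m) * C₁), fun g z => ?_⟩
    choose α hα using g.exists_mem
    simp only [tupleLen_map]
    exact hψ.abs_relLen_sub_le hb hind hK hα z
  have h2 : Close D (fun (g : HomTuple 𝒜 τ) z => window (c * m₀) (tupleLen (g.map hψ)) z)
      (fun g z => ∑ t, window m₀ (tupleLen g) ((z - e t + c - 1) / c)) := by
    obtain ⟨C, hC⟩ := Close.sum (Finset.range (c * m₀)) fun i _ => h1.shift (i : ℤ)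
    refine ⟨C, fun g z => ?_⟩
    have h3 : ∑ t, window m₀ (tupleLen g) ((z - e t + c - 1) / c) =
        ∑ i ∈ Finset.range (c * m₀), ∑ t, relLen (Ideal.span (Set.range g.val))
          (scaledPiece 𝒜 c (e t) (z + i)) := by
      rw [Finset.sum_comm]
      exact Finset.sum_congr rfl fun t _ => (window_scaledPiece hψ.pos (e t) m₀ _ z).symm
    simp only [h3]
    exact hC g z
  have h3 : Close D (fun (g : HomTuple 𝒜 τ) z =>
      ∑ t, window m₀ (tupleLen g) ((z - e t + c - 1) / c))
      (fun g z => ∑ _t : Fin (Module.finrank A B), window m₀ (tupleLen g) (z / c)) := by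
    refine Close.sum _ fun t _ => ?_
    obtain ⟨C, hC⟩ := slowWindow_tupleLen (τ := τ) h0 hm hd (e t + 2)
    refine ⟨C, fun g z => (hC g (z / c) _ (abs_ceilDiv_sub_le hψ.pos (e t) z)).trans ?_⟩
    have : (z / c).toNat ≤ z.toNat := by
      rcases le_or_gt 0 z with hz | hz
      · exact Int.toNat_le_toNat (Int.ediv_le_self _ hz)
      · rw [Int.toNat_of_nonpos (Int.ediv_neg_of_neg_of_pos hz (by exact_mod_cast hψ.pos)).le]
        exact Nat.zero_le _
    gcongr
  obtain ⟨C, hC⟩ := h2.trans h3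
  exact ⟨C, fun g z => by simpa using hC g z⟩

end Graded

end Tuples

section Sequences

lemma tendsto_zero_of_lt_one {a C θ M : ℝ} (ha : 0 ≤ a) (ha1 : a < 1) (hθ : 0 < θ) (hθ1 : θ < 1)
    (hC : 0 ≤ C) {u : ℕ → ℝ} (hM : ∀ n, |u n| ≤ M) (h : ∀ n, |u (n + 1) - a * u n| ≤ C * θ ^ n) :
    Tendsto u atTop (𝓝 0) := by
  obtain ⟨μ, hμ, hμ1⟩ := exists_between (max_lt ha1 hθ1)
  have h1 : a < μ := (le_max_left _ _).trans_lt hμ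
  have h2 : θ < μ := (le_max_right _ _).trans_lt hμ
  have hμ0 : 0 < μ := hθ.trans h2
  set K := max M (C / (μ - a)) with hK
  have hCK : C ≤ K * (μ - a) := (div_le_iff₀ (by linarith)).1 (le_max_right _ _)
  have key : ∀ n, |u n| ≤ K * μ ^ n := by
    intro n
    induction n with
    | zero => rw [pow_zero, mul_one]; exact (hM 0).trans (le_max_left _ _)
    | succ n ih =>
      have h3 : |u (n + 1)| ≤ C * θ ^ n + a * |u n| := by
        have := abs_add_le (u (n + 1) - a * u n) (a * u n)
        rw [sub_add_cancel, abs_mul a, abs_of_nonneg ha] at this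
        linarith [h n]
      have h4 : θ ^ n ≤ μ ^ n := pow_le_pow_left₀ hθ.le h2.le n
      calc |u (n + 1)| ≤ C * μ ^ n + a * (K * μ ^ n) := h3.trans (by gcongr)
        _ ≤ K * (μ - a) * μ ^ n + a * (K * μ ^ n) := by gcongr
        _ = K * μ ^ (n + 1) := by ring
  refine squeeze_zero_norm key ?_
  simpa using (tendsto_pow_atTop_nhds_zero_of_lt_one hμ0.le hμ1).const_mul K

lemma tendsto_zero_of_one_lt {a C θ M : ℝ} (ha1 : 1 < a) (hθ : 0 < θ) (hθ1 : θ < 1)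
    (hC : 0 ≤ C) {u : ℕ → ℝ} (hM : ∀ n, |u n| ≤ M) (h : ∀ n, |u (n + 1) - a * u n| ≤ C * θ ^ n) :
    Tendsto u atTop (𝓝 0) := by
  have ha : 0 < a := by linarith
  have ha' : 0 < a - 1 := by linarith
  have key : ∀ j n, |u n| ≤ M / a ^ j + C / (a - 1) * θ ^ n := by
    intro j
    induction j with
    | zero =>
      intro n
      have : 0 ≤ C / (a - 1) * θ ^ n := by positivity
      simpa using (hM n).trans (le_add_of_nonneg_right this)
    | succ j ih =>
      intro n
      have h3 : a * |u n| ≤ C * θ ^ n + |u (n + 1)| := by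
        have := abs_sub_abs_le_abs_sub (a * u n) (u (n + 1))
        rw [abs_mul, abs_of_pos ha, abs_sub_comm] at this
        linarith [h n]
      have h4 : C / (a - 1) * θ ^ (n + 1) ≤ C / (a - 1) * θ ^ n := by
        gcongr _ * ?_
        exact pow_le_pow_of_le_one hθ.le hθ1.le (Nat.le_succ n)
      rw [← mul_le_mul_iff_of_pos_left ha]
      calc a * |u n| ≤ C * θ ^ n + (M / a ^ j + C / (a - 1) * θ ^ n) := by
            linarith [ih (n + 1)]
        _ = a * (M / a ^ (j + 1) + C / (a - 1) * θ ^ n) := by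
            field_simp
            ring
  have key' : ∀ n, |u n| ≤ C / (a - 1) * θ ^ n := by
    intro n
    have h1 : Tendsto (fun j : ℕ => M / a ^ j + C / (a - 1) * θ ^ n) atTop
        (𝓝 (0 + C / (a - 1) * θ ^ n)) :=
      ((tendsto_pow_atTop_atTop_of_one_lt ha1).const_div_atTop M).add_const _
    rw [zero_add] at h1
    exact ge_of_tendsto' h1 fun j => key j n
  refine squeeze_zero_norm key' ?_
  simpa using (tendsto_pow_atTop_nhds_zero_of_lt_one hθ.le hθ1).const_mul (C / (a - 1))

/-- A bounded sequence satisfying an approximate linear recursion with geometric error converges. -/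
lemma exists_tendsto_of_recursion {a C θ M : ℝ} (ha : 0 ≤ a) (hθ : 0 < θ) (hθ1 : θ < 1)
    (hC : 0 ≤ C) {u : ℕ → ℝ} (hM : ∀ n, |u n| ≤ M) (h : ∀ n, |u (n + 1) - a * u n| ≤ C * θ ^ n) :
    ∃ l, Tendsto u atTop (𝓝 l) := by
  rcases lt_trichotomy a 1 with h1 | rfl | h1
  · exact ⟨0, tendsto_zero_of_lt_one ha h1 hθ hθ1 hC hM h⟩
  · refine cauchySeq_tendsto_of_complete (cauchySeq_of_le_geometric θ C hθ1 fun n => ?_)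
    rw [dist_comm, Real.dist_eq]
    simpa using h n
  · exact ⟨0, tendsto_zero_of_one_lt h1 hθ hθ1 hC hM h⟩

lemma floor_mul_add_one_le {x q : ℝ} (hx : 0 ≤ x) (hq : 1 ≤ q) (m : ℕ) :
    ((⌊x * q⌋₊ * m + 1 : ℕ) : ℝ) ≤ (x * m + 1) * q := by
  have := Nat.floor_le (show 0 ≤ x * q by positivity)
  push_cast
  calc (⌊x * q⌋₊ : ℝ) * m + 1 ≤ x * q * m + q := by gcongr
    _ = _ := by ring

lemma abs_div_le_of_abs_le {x : ℝ} (hx : 0 ≤ x) {p : ℕ} (hp : 0 < p) {n m C D : ℕ} {u : ℤ}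
    (hu : |u| ≤ C * ((((⌊x * (p ^ n : ℕ)⌋₊ * m : ℕ) : ℤ).toNat + 1 : ℕ) : ℤ) ^ D) :
    |(u : ℝ) / ((p : ℝ) ^ n) ^ D| ≤ C * (x * m + 1) ^ D := by
  have hp' : (1 : ℝ) ≤ p := by exact_mod_cast hp
  have hq : (1 : ℝ) ≤ (p ^ n : ℕ) := by exact_mod_cast Nat.pow_pos hp
  have h2 : |(u : ℝ)| ≤ C * ((⌊x * (p ^ n : ℕ)⌋₊ * m + 1 : ℕ) : ℝ) ^ D := by
    rw [Int.toNat_natCast] at hu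
    exact_mod_cast hu
  have h3 := floor_mul_add_one_le hx hq m
  have h4 : (((⌊x * (p ^ n : ℕ)⌋₊ * m + 1 : ℕ) : ℝ)) ^ D ≤ ((x * m + 1) * (p ^ n : ℕ)) ^ D :=
    pow_le_pow_left₀ (by positivity) h3 D
  rw [abs_div, abs_of_pos (show 0 < ((p : ℝ) ^ n) ^ D by positivity), div_le_iff₀ (by positivity)]
  calc |(u : ℝ)| ≤ C * ((x * m + 1) * (p ^ n : ℕ)) ^ D := h2.trans (by gcongr)
    _ = _ := by push_cast; rw [mul_pow, mul_assoc]

lemma abs_div_le_geometric {x : ℝ} (hx : 0 ≤ x) {p : ℕ} (hp : 0 < p) {n m C D : ℕ} {u : ℤ}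
    (hu : |u| ≤ C * ((((⌊x * (p ^ n : ℕ)⌋₊ * m : ℕ) : ℤ).toNat + 1 : ℕ) : ℤ) ^ D) :
    |(u : ℝ) / ((p : ℝ) ^ n) ^ (D + 1)| ≤ C * (x * m + 1) ^ D * (1 / p) ^ n := by
  have h := abs_div_le_of_abs_le hx hp hu
  rw [pow_succ, ← div_div, abs_div, abs_of_pos (show 0 < (p : ℝ) ^ n by positivity), div_eq_mul_inv,
    one_div, inv_pow]
  gcongr

lemma tendsto_div_zero {x : ℝ} (hx : 0 ≤ x) {p : ℕ} (hp : 1 < p) {m C D : ℕ} {u : ℕ → ℤ}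
    (hu : ∀ n, |u n| ≤
      C * ((((⌊x * (p ^ n : ℕ)⌋₊ * m : ℕ) : ℤ).toNat + 1 : ℕ) : ℤ) ^ D) :
    Tendsto (fun n => (u n : ℝ) / ((p : ℝ) ^ n) ^ (D + 1)) atTop (𝓝 0) := by
  refine squeeze_zero_norm (fun n => abs_div_le_geometric hx (by omega) (hu n)) ?_
  have hp' : (1 : ℝ) < p := by exact_mod_cast hp
  simpa using (tendsto_pow_atTop_nhds_zero_of_lt_one (r := (1 / p : ℝ)) (by positivity)
    (by rw [div_lt_one (by positivity)]; exact hp')).const_mul (C * (x * m + 1) ^ D)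

lemma floor_mul_bounds {y : ℝ} (hy : 0 ≤ y) (l : ℕ) (hl : 0 < l) :
    ⌊y⌋₊ * l ≤ ⌊y * l⌋₊ ∧ ⌊y * l⌋₊ < (⌊y⌋₊ + 1) * l := by
  have h1 := Nat.floor_le hy
  have h2 := Nat.lt_floor_add_one y
  have hl' : (0 : ℝ) < l := by exact_mod_cast hl
  constructor
  · apply Nat.le_floor
    push_cast
    gcongr
  · rw [Nat.floor_lt (by positivity)]
    push_cast
    gcongr

end Sequences

section Windows

variable {X : Type*} {D : ℕ} {L : X → ℤ → ℤ}

lemma SlowWindow.exists_window_mul_bound {m : ℕ} (H : SlowWindow D m L) (l : ℕ) :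
    ∃ C : ℕ, ∀ x z, |window (l * m) (L x) z - l * window m (L x) z| ≤
      C * ((z.toNat + 1 : ℕ) : ℤ) ^ D := by
  obtain ⟨C, hC⟩ := H (l * m)
  refine ⟨l * C, fun x z => ?_⟩
  have h1 : window (l * m) (L x) z - l * window m (L x) z =
      ∑ s ∈ Finset.range l, (window m (L x) (z + (s * m : ℕ)) - window m (L x) z) := by
    rw [window_mul, Finset.sum_sub_distrib]
    simp
  rw [h1]
  refine (Finset.abs_sum_le_sum_abs _ _).trans ((Finset.sum_le_card_nsmul _ _
    (C * ((z.toNat + 1 : ℕ) : ℤ) ^ D) fun s hs => hC x z _ ?_).trans ?_)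
  · rw [add_sub_cancel_left, Nat.abs_cast]
    have := Finset.mem_range.1 hs
    exact_mod_cast Nat.mul_le_mul_right m this.le
  · simp [mul_assoc]

lemma exists_window_bound {C : ℕ} (h : ∀ x z, |L x z| ≤ C * ((z.toNat + 1 : ℕ) : ℤ) ^ D) (m : ℕ) :
    ∃ C' : ℕ, ∀ x z, |window m (L x) z| ≤ C' * ((z.toNat + 1 : ℕ) : ℤ) ^ D := by
  have h1 : Close D L (fun _ _ => 0) := ⟨C, fun x z => by simpa using h x z⟩
  obtain ⟨C', hC'⟩ := Close.sum (Finset.range m) fun i _ => h1.shift (i : ℤ)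
  exact ⟨C', fun x z => by simpa [window] using hC' x z⟩

end Windows

section Frobenius

variable {k A B : Type*} [Field k] [CommRing A] [Algebra k A] [CommRing B] [Algebra k B]

lemma frobeniusPow_span (p : ℕ) [Fact p.Prime] [CharP A p] (n : ℕ) {τ : Type*} (g : τ → A) :
    (Ideal.span (Set.range g)).frobeniusPow (p ^ n) =
      Ideal.span (Set.range fun i => g i ^ p ^ n) := by
  have h : ∀ I : Ideal A, I.frobeniusPow (p ^ n) = I.map (iterateFrobenius A p n) := fun I => rfl
  rw [h, Ideal.map_span, ← Set.range_comp]
  rfl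

lemma gradedPieceLen_eq {𝒜 : ℕ → Submodule k A} (J : Ideal A) (j : ℕ) [FiniteDimensional k (𝒜 j)] :
    (gradedPieceLen k 𝒜 (J.restrictScalars k) j : ℤ) = relLen J (zpiece 𝒜 j) := by
  rw [zpiece_natCast, relLen, gradedPieceLen]
  have h1 := Submodule.finrank_quotient_add_finrank ((J.restrictScalars k).comap (𝒜 j).subtype)
  have h2 := Submodule.finrank_map_subtype_eq (𝒜 j) ((J.restrictScalars k).comap (𝒜 j).subtype)
  rw [Submodule.map_comap_subtype, inf_comm] at h2
  omega

lemma hkStep_eq {𝒜 : ℕ → Submodule k A} [∀ j, FiniteDimensional k (𝒜 j)] (p : ℕ) [Fact p.Prime]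
    [CharP A p] {τ : Type*} {I : Ideal A} {g : τ → A} (hI : I = Ideal.span (Set.range g))
    {n : ℕ} {G : HomTuple 𝒜 τ} (hG : ∀ i, G.val i = g i ^ p ^ n) (d m : ℕ) (x : ℝ) :
    hkStep k 𝒜 I d m p n x =
      (window m (tupleLen G) ((⌊x * (p ^ n : ℕ)⌋₊ * m : ℕ) : ℤ) : ℝ) / ((p : ℝ) ^ n) ^ (d - 1) := by
  have h1 : I.frobeniusPow (p ^ n) = Ideal.span (Set.range G.val) := by
    rw [hI, frobeniusPow_span]
    congr 2
    exact (funext hG).symm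
  rw [hkStep, window, h1]
  congr 1
  rw [Int.cast_sum]
  refine Finset.sum_congr rfl fun i _ => ?_
  rw [smul_eq_mul, Ideal.mul_top]
  have h2 := gradedPieceLen_eq (𝒜 := 𝒜) (Ideal.span (Set.range G.val))
    (⌊x * (p ^ n : ℕ)⌋₊ * m + i)
  rw [tupleLen]
  rw [← Nat.cast_add, ← h2, Int.cast_natCast]

lemma isScaledGraded_frobenius (p : ℕ) [Fact p.Prime] [CharP k p] [CharP A p] [IsReduced A]
    (𝒜 : ℕ → Submodule k A) [SetLike.GradedMonoid 𝒜] :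
    IsScaledGraded 𝒜 𝒜 (frobenius k p) p (frobenius A p) where
  pos := (Fact.out : p.Prime).pos
  injective := frobenius_inj A p
  map_smul l a := by simp [frobenius_def, smul_pow]
  map_mem i a ha := by simpa [frobenius_def] using SetLike.pow_mem_graded p ha

lemma finite_frobenius (k : Type*) [Field k] [Algebra k A] (p : ℕ) [Fact p.Prime] [CharP k p]
    [CharP A p] [PerfectField k] [Algebra.FiniteType k A] : (frobenius A p).Finite := by
  apply RingHom.IsIntegral.to_finite
  · intro x
    refine ⟨Polynomial.X ^ p - Polynomial.C x, Polynomial.monic_X_pow_sub_C _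
      (Fact.out : p.Prime).ne_zero, ?_⟩
    simp [frobenius_def]
  · have h1 : (algebraMap k A).FiniteType := by
      rw [RingHom.finiteType_algebraMap]; infer_instance
    have h2 : (frobenius k p).FiniteType :=
      RingHom.FiniteType.of_surjective _ (surjective_frobenius k p)
    have h3 := h1.comp h2
    rw [RingHom.frobenius_comm] at h3
    exact RingHom.FiniteType.of_comp_finiteType h3

/-- The tuple of `p ^ n`-th powers. -/
def HomTuple.frob {𝒜 : ℕ → Submodule k A} [SetLike.GradedMonoid 𝒜] {τ : Type*}
    (g : HomTuple 𝒜 τ) (q : ℕ) : HomTuple 𝒜 τ :=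
  ⟨fun i => g.val i ^ q, fun i => (g.exists_mem i).elim fun _ ha =>
    ⟨_, SetLike.pow_mem_graded q ha⟩⟩

variable {𝒜 : ℕ → Submodule k A} [GradedAlgebra 𝒜] [IsDomain A] [IsNoetherianRing A]
  {τ : Type*} [Fintype τ] {D : ℕ}

lemma exists_window_frobenius_bound [PerfectField k] (p : ℕ) [Fact p.Prime] [CharP k p] [CharP A p]
    [Algebra.FiniteType k A] (h0 : 𝒜 0 ≤ Submodule.span k {1})
    {m₀ : ℕ} (hm : ∀ c : ℕ, (∀ m, 0 < m → 𝒜 m ≠ ⊥ → c ∣ m) → c ∣ m₀)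
    (hd : ringKrullDim A ≤ (D + 2 : ℕ)) :
    ∃ r C : ℕ, ∀ (g : HomTuple 𝒜 τ) (z : ℤ), |window (p * m₀) (tupleLen (g.frob p)) z -
      r * window m₀ (tupleLen g) (z / p)| ≤ C * ((z.toNat + 1 : ℕ) : ℤ) ^ D := by
  obtain ⟨C₀, hC₀⟩ := exists_piece_bound h0 (d := D + 1) hd
  have : ∀ m, FiniteDimensional k (𝒜 m) := fun m => (hC₀ m).1
  have : RingHomSurjective (frobenius k p) := ⟨surjective_frobenius k p⟩
  obtain ⟨C, hC⟩ := @exists_window_map_bound k A A _ _ _ _ _ 𝒜 𝒜 _ _ _ _ τ _ D (frobenius k p) _ p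
    (frobenius A p) (isScaledGraded_frobenius p 𝒜) (frobenius A p).toAlgebra.toModule
    (finite_frobenius k p) (fun _ _ => rfl) h0 _ m₀ hm hd
  exact ⟨_, C, hC⟩

lemma abs_sub_le_of_abs_sub_le {v a b c X Y Z : ℤ} (h₁ : |v - a| ≤ X) (h₂ : |v - b| ≤ Y)
    (h₃ : |b - c| ≤ Z) : |a - c| ≤ X + Y + Z := by
  rw [abs_le] at *
  constructor <;> linarith

/-- Existence of the Hilbert-Kunz density function. -/
theorem exists_tendsto_hkStep [PerfectField k] (p : ℕ) [Fact p.Prime] [CharP k p] [CharP A p]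
    [Algebra.FiniteType k A] (h0 : 𝒜 0 ≤ Submodule.span k {1})
    {m₀ : ℕ} (hm : ∀ c : ℕ, (∀ m, 0 < m → 𝒜 m ≠ ⊥ → c ∣ m) → c ∣ m₀)
    (hd : ringKrullDim A ≤ (D + 2 : ℕ)) (g : HomTuple 𝒜 τ) {x : ℝ} (hx : 0 ≤ x) :
    ∃ l : ℝ, Tendsto (fun n => hkStep k 𝒜 (Ideal.span (Set.range g.val)) (D + 2) m₀ p n x)
      atTop (𝓝 l) := by
  obtain ⟨C₀, hC₀⟩ := exists_piece_bound h0 (d := D + 1) hd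
  have : ∀ m, FiniteDimensional k (𝒜 m) := fun m => (hC₀ m).1
  have hp : 1 < p := (Fact.out : p.Prime).one_lt
  have hp0 : 0 < p := by omega
  have hpR : (1 : ℝ) < p := by exact_mod_cast hp
  have hpR0 : (0 : ℝ) < p := by linarith
  obtain ⟨r, C₁, hC₁⟩ := exists_window_frobenius_bound (τ := τ) p h0 hm hd
  have hslow := slowWindow_tupleLen (τ := τ) h0 hm hd
  obtain ⟨C₂, hC₂⟩ := hslow m₀
  obtain ⟨C₃, hC₃⟩ := hslow.exists_window_mul_bound p
  have hlen : ∀ (G : HomTuple 𝒜 τ) (z : ℤ),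
      |tupleLen G z| ≤ C₀ * ((z.toNat + 1 : ℕ) : ℤ) ^ (D + 1) := by
    intro G z
    rcases lt_or_ge z 0 with hz | hz
    · rw [tupleLen, zpiece_of_neg hz, relLen_bot, abs_zero]
      positivity
    · lift z to ℕ using hz
      rw [tupleLen, zpiece_natCast, relLen, Int.toNat_natCast]
      have h1 : Module.finrank k ↥((Ideal.span (Set.range G.val)).restrictScalars k ⊓ 𝒜 z) ≤
        Module.finrank k (𝒜 z) := Submodule.finrank_mono inf_le_right
      have h2 := (hC₀ z).2
      zify at h1 h2
      rw [abs_of_nonneg (by omega)]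
      push_cast
      omega
  obtain ⟨C₄, hC₄⟩ := exists_window_bound hlen m₀
  set G : ℕ → HomTuple 𝒜 τ := fun n => g.frob (p ^ n) with hGdef
  have hG : ∀ n, G (n + 1) = (G n).frob p := fun n => by
    simp only [hGdef, HomTuple.frob, pow_succ, pow_mul]
  set z : ℕ → ℕ := fun n => ⌊x * (p ^ n : ℕ)⌋₊ * m₀ with hz
  set w : ℕ → ℤ := fun n => window m₀ (tupleLen (G n)) (z n) with hw
  have hstep : ∀ n, hkStep k 𝒜 (Ideal.span (Set.range g.val)) (D + 2) m₀ p n x =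
      (w n : ℝ) / ((p : ℝ) ^ n) ^ (D + 1) := fun n => by
    rw [hkStep_eq p rfl (G := G n) (fun i => rfl)]
    rfl
  have hzz : ∀ n, z n * p ≤ z (n + 1) ∧ z (n + 1) ≤ (z n + m₀) * p := by
    intro n
    obtain ⟨h1, h2⟩ := floor_mul_bounds (y := x * (p ^ n : ℕ)) (by positivity) p hp0
    have h3 : x * (p ^ n : ℕ) * p = x * (p ^ (n + 1) : ℕ) := by push_cast; ring
    rw [h3] at h1 h2
    simp only [hz]
    constructor
    · calc _ = ⌊x * (p ^ n : ℕ)⌋₊ * p * m₀ := by ring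
        _ ≤ _ := Nat.mul_le_mul_right _ h1
    · calc _ ≤ (⌊x * (p ^ n : ℕ)⌋₊ + 1) * p * m₀ := Nat.mul_le_mul_right _ h2.le
        _ = _ := by ring
  have hrec : ∀ n, |p * w (n + 1) - r * w n| ≤
      (C₃ + C₁ + r * C₂ : ℕ) * ((((z (n + 1) : ℕ) : ℤ).toNat + 1 : ℕ) : ℤ) ^ D := by
    intro n
    obtain ⟨h1, h2⟩ := hzz n
    have e1 := hC₃ (G (n + 1)) (z (n + 1))
    have e2 := hC₁ (G n) (z (n + 1))
    rw [← hG] at e2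
    have e3 := hC₂ (G n) (z n) (z (n + 1) / p) (by
      have a1 : z n ≤ z (n + 1) / p := (Nat.le_div_iff_mul_le hp0).2 h1
      have a2 : z (n + 1) / p ≤ z n + m₀ := Nat.div_le_of_le_mul (by linarith)
      have a3 : ((z (n + 1) : ℤ) / p) = ((z (n + 1) / p : ℕ) : ℤ) := by push_cast; rfl
      rw [a3, abs_le]
      omega)
    have e4 : ((((z n : ℕ) : ℤ).toNat + 1 : ℕ) : ℤ) ^ D ≤
        ((((z (n + 1) : ℕ) : ℤ).toNat + 1 : ℕ) : ℤ) ^ D := by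
      have : z n ≤ z (n + 1) := (Nat.le_mul_of_pos_right _ hp0).trans h1
      simp only [Int.toNat_natCast]
      gcongr
    have e5 : (r : ℤ) * |window m₀ (tupleLen (G n)) (z (n + 1) / p) - w n| ≤
        r * (C₂ * ((((z (n + 1) : ℕ) : ℤ).toNat + 1 : ℕ) : ℤ) ^ D) :=
      mul_le_mul_of_nonneg_left (e3.trans (mul_le_mul_of_nonneg_left e4 (by positivity)))
        (by positivity)
    rw [← Nat.abs_cast r, ← abs_mul, Nat.abs_cast r, mul_sub] at e5
    refine (abs_sub_le_of_abs_sub_le e1 e2 e5).trans_eq ?_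
    push_cast
    ring
  have hbound : ∀ n, |(w n : ℝ) / ((p : ℝ) ^ n) ^ (D + 1)| ≤ C₄ * (x * m₀ + 1) ^ (D + 1) :=
    fun n => abs_div_le_of_abs_le hx hp0 (hC₄ (G n) (z n))
  simp only [hstep]
  refine exists_tendsto_of_recursion (a := r / (p : ℝ) ^ (D + 2)) (θ := 1 / p)
    (C := (C₃ + C₁ + r * C₂ : ℕ) * (x * m₀ + 1) ^ D * (1 / p) ^ 2) (by positivity) (by positivity)
    (by rwa [div_lt_one hpR0]) (by positivity) hbound fun n => ?_
  have h1 := abs_div_le_geometric hx hp0 (hrec n)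
  have h2 : (w (n + 1) : ℝ) / ((p : ℝ) ^ (n + 1)) ^ (D + 1) -
      r / (p : ℝ) ^ (D + 2) * ((w n : ℝ) / ((p : ℝ) ^ n) ^ (D + 1)) =
      (1 / p) * (((p * w (n + 1) - r * w n : ℤ) : ℝ) / ((p : ℝ) ^ (n + 1)) ^ (D + 1)) := by
    push_cast
    field_simp
    ring
  rw [h2, abs_mul, abs_of_pos (show (0 : ℝ) < 1 / p by positivity)]
  refine (mul_le_mul_of_nonneg_left h1 (by positivity)).trans_eq ?_
  ring

end Frobenius

section Comparison

variable {k A B : Type*} [Field k] [CommRing A] [Algebra k A] [CommRing B] [Algebra k B]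
  {𝒜 : ℕ → Submodule k A} {ℬ : ℕ → Submodule k B} [GradedAlgebra 𝒜] [GradedAlgebra ℬ]
  [IsDomain A] [IsNoetherianRing A] {τ : Type*} [Fintype τ] {D : ℕ}

/-- Along a module-finite map, the step function is asymptotically multiplied by the rank. -/
lemma tendsto_hkStep_sub_finrank_mul (p : ℕ) [Fact p.Prime] [CharP A p] [CharP B p] {ψ : A →+* B}
    (hψ : IsScaledGraded 𝒜 ℬ (RingHom.id k) 1 ψ) [Module A B] [Module.Finite A B]
    (hsmul : ∀ (a : A) (x : B), a • x = ψ a * x)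
    (h0 : 𝒜 0 ≤ Submodule.span k {1}) [∀ m, FiniteDimensional k (ℬ m)]
    {m₀ : ℕ} (hm : ∀ c : ℕ, (∀ m, 0 < m → 𝒜 m ≠ ⊥ → c ∣ m) → c ∣ m₀)
    (hd : ringKrullDim A ≤ (D + 2 : ℕ)) (g : HomTuple 𝒜 τ) {x : ℝ} (hx : 0 ≤ x) :
    Tendsto (fun n =>
      hkStep k ℬ ((Ideal.span (Set.range g.val)).map ψ) (D + 2) m₀ p n x -
        Module.finrank A B * hkStep k 𝒜 (Ideal.span (Set.range g.val)) (D + 2) m₀ p n x)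
      atTop (𝓝 0) := by
  obtain ⟨C₀, hC₀⟩ := exists_piece_bound h0 (d := D + 1) hd
  have : ∀ m, FiniteDimensional k (𝒜 m) := fun m => (hC₀ m).1
  obtain ⟨C, hC⟩ := exists_window_map_bound (τ := τ) hψ hsmul h0 hm hd
  simp only [one_mul, Nat.cast_one, Int.ediv_one] at hC
  refine (tendsto_div_zero hx (Fact.out : p.Prime).one_lt
    fun n => hC (g.frob (p ^ n)) ((⌊x * (p ^ n : ℕ)⌋₊ * m₀ : ℕ) : ℤ)).congr fun n => ?_
  rw [hkStep_eq p rfl (G := g.frob (p ^ n)) (fun i => rfl),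
    hkStep_eq p (τ := τ) (g := (g.map hψ).val) (by rw [Ideal.map_span, ← Set.range_comp]; rfl)
      (G := (g.frob (p ^ n)).map hψ) (fun i => map_pow ψ _ _)]
  push_cast
  rw [sub_div, mul_div_assoc]

lemma tendsto_mul_hkStep_sub (p : ℕ) [Fact p.Prime] [CharP A p]
    (h0 : 𝒜 0 ≤ Submodule.span k {1})
    {n₀ : ℕ} (hn : ∀ c : ℕ, (∀ m, 0 < m → 𝒜 m ≠ ⊥ → c ∣ m) → c ∣ n₀)
    (hd : ringKrullDim A ≤ (D + 2 : ℕ)) (g : HomTuple 𝒜 τ) {x : ℝ} (hx : 0 ≤ x) {l : ℕ}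
    (hl : 0 < l) :
    Tendsto (fun n =>
      hkStep k 𝒜 (Ideal.span (Set.range g.val)) (D + 2) (l * n₀) p n x -
        l * hkStep k 𝒜 (Ideal.span (Set.range g.val)) (D + 2) n₀ p n (x * l))
      atTop (𝓝 0) := by
  obtain ⟨C₀, hC₀⟩ := exists_piece_bound h0 (d := D + 1) hd
  have : ∀ m, FiniteDimensional k (𝒜 m) := fun m => (hC₀ m).1
  have hslow := slowWindow_tupleLen (τ := τ) h0 hn hd
  obtain ⟨C₁, hC₁⟩ := hslow.exists_window_mul_bound l
  obtain ⟨C₂, hC₂⟩ := hslow (l * n₀)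
  set G : ℕ → HomTuple 𝒜 τ := fun n => g.frob (p ^ n)
  set z : ℕ → ℕ := fun n => ⌊x * (p ^ n : ℕ)⌋₊ * (l * n₀) with hz
  set z' : ℕ → ℕ := fun n => ⌊x * l * (p ^ n : ℕ)⌋₊ * n₀ with hz'
  have hzz : ∀ n, |(z' n : ℤ) - z n| ≤ ((l * n₀ : ℕ) : ℤ) := by
    intro n
    obtain ⟨h1, h2⟩ := floor_mul_bounds (y := x * (p ^ n : ℕ)) (by positivity) l hl
    rw [mul_right_comm] at h1 h2
    have h3 : z n ≤ z' n := by
      simp only [hz, hz']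
      rw [← mul_assoc]
      exact Nat.mul_le_mul_right _ h1
    have h4 : z' n ≤ z n + l * n₀ := by
      simp only [hz, hz']
      calc _ ≤ (⌊x * (p ^ n : ℕ)⌋₊ + 1) * l * n₀ := Nat.mul_le_mul_right _ h2.le
        _ = _ := by ring
    rw [abs_le]
    omega
  refine (tendsto_div_zero (C := C₁ + l * C₂) (D := D) (m := l * n₀)
    (u := fun n => window (l * n₀) (tupleLen (G n)) (z n) - l * window n₀ (tupleLen (G n)) (z' n))
    hx (Fact.out : p.Prime).one_lt fun n => ?_).congr fun n => ?_
  · have e1 := hC₁ (G n) (z n)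
    have e2 := mul_le_mul_of_nonneg_left (hC₂ (G n) (z n) (z' n) (hzz n))
      (Nat.cast_nonneg (α := ℤ) l)
    rw [← Nat.abs_cast l, ← abs_mul, Nat.abs_cast l, mul_sub, abs_sub_comm] at e2
    refine (abs_sub_le _ _ _).trans ((add_le_add e1 e2).trans_eq ?_)
    simp only [hz]
    push_cast
    ring
  · rw [hkStep_eq p rfl (G := G n) (fun i => rfl), hkStep_eq p rfl (G := G n) (fun i => rfl)]
    push_cast
    rw [sub_div, mul_div_assoc]
    simp only [hz, hz']
    push_cast
    rfl

lemma exists_homTuple {I : Ideal A} (hI : I.IsHomogeneous 𝒜) :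
    ∃ (t : ℕ) (g : HomTuple 𝒜 (Fin t)), I = Ideal.span (Set.range g.val) := by
  obtain ⟨s, hs⟩ := (Ideal.IsHomogeneous.iff_exists 𝒜 I).1 hI
  obtain ⟨s', hs', h⟩ := (Submodule.fg_span_iff_fg_span_finset_subset (R := A) _).1
    (hs ▸ IsNoetherian.noetherian I)
  refine ⟨s'.card, ⟨fun i => (s'.equivFin.symm i : A), fun i => ?_⟩, ?_⟩
  · obtain ⟨y, -, hy⟩ := hs' (s'.equivFin.symm i).2
    rw [← hy]
    exact y.2
  · rw [hs]
    refine h.trans (congrArg (Submodule.span A) ?_)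
    rw [Set.range_comp' Subtype.val, s'.equivFin.symm.surjective.range_eq]
    simp

lemma finrank_fractionRing_tensorProduct (M : Type*) [AddCommGroup M] [Module A M] :
    Module.finrank (FractionRing A) (TensorProduct A (FractionRing A) M) = Module.finrank A M := by
  rw [IsFractionRing.finrank_right_eq A (FractionRing A)]
  exact IsLocalizedModule.finrank_eq (nonZeroDivisors A) (TensorProduct.mk A (FractionRing A) M 1)
    le_rfl

end Comparison

end HKDensity

/-- (Lemma 4.3 of the paper.)  Let `S → R` be an injective
degree-preserving module-finite map of ℕ-graded Noetherian domains, `(S, I)` a graded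
pair of dimension `d`, `dim R = d`, `m₀ = gcd {n > 0 | S_n ≠ 0}`,
`n₀ = gcd {n > 0 | R_n ≠ 0}`.  Then `l₀ = m₀/n₀` is a positive integer and
`l₀·f_{R,IR}(x l₀) = f_{R_S,I}(x) = rank_S R · f_{S,I}(x)` for all `x ≥ 0`; in
particular `f_{R,IR} = f_{R_S,I}` when `m₀ = n₀`. -/
theorem statement10
    (k : Type*) [Field k] [PerfectField k] (p : ℕ) [Fact p.Prime] [CharP k p]
    (S : Type*) [CommRing S] [IsDomain S] [IsNoetherianRing S] [Algebra k S]
    [Algebra.FiniteType k S]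
    (𝒜 : ℕ → Submodule k S) [GradedAlgebra 𝒜]
    (h𝒜0 : 𝒜 0 ≤ Submodule.span k {1})
    (d : ℕ) (hd : 2 ≤ d) (hdimS : ringKrullDim S = d)
    (I : Ideal S) (hI : I.IsHomogeneous 𝒜) (hIcolen : FiniteDimensional k (S ⧸ I))
    (R : Type*) [CommRing R] [IsDomain R] [IsNoetherianRing R] [Algebra k R]
    (ℬ : ℕ → Submodule k R) [GradedAlgebra ℬ]
    (hℬ0 : ℬ 0 ≤ Submodule.span k {1})
    (hdimR : ringKrullDim R = d)
    -- the injective degree-preserving module-finite map `S → R`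
    (φ : S →ₐ[k] R) (hφinj : Function.Injective φ)
    (hφdeg : ∀ n : ℕ, ∀ x ∈ 𝒜 n, φ x ∈ ℬ n)
    [Module S R] (hsmul : ∀ (s : S) (r : R), s • r = φ s * r) [Module.Finite S R]
    -- the gcds of the degrees
    (m₀ : ℕ) (hm₀pos : 0 < m₀)
    (hm₀dvd : ∀ m, 0 < m → 𝒜 m ≠ ⊥ → m₀ ∣ m)
    (hm₀gcd : ∀ c : ℕ, (∀ m, 0 < m → 𝒜 m ≠ ⊥ → c ∣ m) → c ∣ m₀)
    (n₀ : ℕ) (hn₀pos : 0 < n₀)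
    (hn₀dvd : ∀ m, 0 < m → ℬ m ≠ ⊥ → n₀ ∣ m)
    (hn₀gcd : ∀ c : ℕ, (∀ m, 0 < m → ℬ m ≠ ⊥ → c ∣ m) → c ∣ n₀) :
    n₀ ∣ m₀ ∧ 0 < m₀ / n₀ ∧
    ∃ FR FRS FS : ℝ → ℝ,
      (∀ x : ℝ, 0 ≤ x → Tendsto
        (fun n => hkStep k ℬ (Ideal.map φ.toRingHom I) d n₀ p n x) atTop (𝓝 (FR x))) ∧
      (∀ x : ℝ, 0 ≤ x → Tendsto
        (fun n => hkStep k ℬ (Ideal.map φ.toRingHom I) d m₀ p n x) atTop (𝓝 (FRS x))) ∧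
      (∀ x : ℝ, 0 ≤ x → Tendsto
        (fun n => hkStep k 𝒜 I d m₀ p n x) atTop (𝓝 (FS x))) ∧
      (∀ x : ℝ, 0 ≤ x →
        ((m₀ / n₀ : ℕ) : ℝ) * FR (x * ((m₀ / n₀ : ℕ) : ℝ)) = FRS x) ∧
      (∀ x : ℝ, 0 ≤ x → FRS x =
        (Module.finrank (FractionRing S) (TensorProduct S (FractionRing S) R) : ℝ) * FS x) ∧
      (m₀ = n₀ → ∀ x : ℝ, 0 ≤ x → FR x = FRS x) := by
  have hp : p.Prime := Fact.out
  obtain ⟨D, rfl⟩ : ∃ D, d = D + 2 := ⟨d - 2, by omega⟩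
  have : CharP S p := charP_of_injective_algebraMap (algebraMap k S).injective p
  have : CharP R p := charP_of_injective_algebraMap (algebraMap k R).injective p
  have hdvd : n₀ ∣ m₀ := hm₀gcd _ fun m hm h𝒜 => hn₀dvd m hm fun hℬ => by
    obtain ⟨y, hy, hy0⟩ := Submodule.exists_mem_ne_zero_of_ne_bot h𝒜
    have := hφdeg m y hy
    rw [hℬ, Submodule.mem_bot] at this
    exact hy0 (hφinj (this.trans (map_zero φ).symm))
  have hl : 0 < m₀ / n₀ := Nat.div_pos (Nat.le_of_dvd hm₀pos hdvd) hn₀pos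
  refine ⟨hdvd, hl, ?_⟩
  have hlm : m₀ / n₀ * n₀ = m₀ := Nat.div_mul_cancel hdvd
  set l := m₀ / n₀
  have hl' : (l : ℝ) ≠ 0 := by positivity
  obtain ⟨C₀, hC₀⟩ := HKDensity.exists_piece_bound hℬ0 (d := D + 1) hdimR.le
  have : ∀ m, FiniteDimensional k (ℬ m) := fun m => (hC₀ m).1
  obtain ⟨t, g, rfl⟩ := HKDensity.exists_homTuple hI
  have hψ : HKDensity.IsScaledGraded 𝒜 ℬ (RingHom.id k) 1 φ.toRingHom :=
    { pos := one_pos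
      injective := hφinj
      map_smul := fun c a => map_smul φ c a
      map_mem := fun i a ha => by simpa using hφdeg i a ha }
  have hS : ∀ x : ℝ, ∃ y, 0 ≤ x → Tendsto
      (fun n => hkStep k 𝒜 (Ideal.span (Set.range g.val)) (D + 2) m₀ p n x) atTop (𝓝 y) := by
    intro x
    by_cases hx : 0 ≤ x
    · obtain ⟨y, hy⟩ := HKDensity.exists_tendsto_hkStep p h𝒜0 hm₀gcd hdimS.le g hx
      exact ⟨y, fun _ => hy⟩
    · exact ⟨0, fun h => absurd h hx⟩
  choose FS hFS using hS
  have hFRS : ∀ x : ℝ, 0 ≤ x → Tendsto (fun n => hkStep k ℬ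
      (Ideal.map φ.toRingHom (Ideal.span (Set.range g.val))) (D + 2) m₀ p n x) atTop
      (𝓝 (Module.finrank S R * FS x)) := by
    intro x hx
    have h1 := (HKDensity.tendsto_hkStep_sub_finrank_mul p hψ hsmul h𝒜0 hm₀gcd hdimS.le g hx).add
      ((hFS x hx).const_mul (Module.finrank S R : ℝ))
    simpa using h1
  have hFR : ∀ x : ℝ, 0 ≤ x → Tendsto (fun n => hkStep k ℬ
      (Ideal.map φ.toRingHom (Ideal.span (Set.range g.val))) (D + 2) n₀ p n x) atTop
      (𝓝 (Module.finrank S R * FS (x / l) / l)) := by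
    intro x hx
    have hx' : 0 ≤ x / l := by positivity
    have h1 := HKDensity.tendsto_mul_hkStep_sub p hℬ0 hn₀gcd hdimR.le (g.map hψ) hx' hl
    have h2 : Ideal.span (Set.range (g.map hψ).val) =
        Ideal.map φ.toRingHom (Ideal.span (Set.range g.val)) := by
      rw [Ideal.map_span, ← Set.range_comp]
      rfl
    rw [h2, hlm, div_mul_cancel₀ _ hl'] at h1
    have h3 := ((hFRS _ hx').sub h1).div_const (l : ℝ)
    rw [sub_zero] at h3
    refine h3.congr fun n => ?_
    rw [sub_sub_cancel, mul_div_cancel_left₀ _ hl']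
  refine ⟨_, _, FS, hFR, hFRS, hFS, fun x _ => ?_, fun x _ => ?_, fun h x _ => ?_⟩
  · rw [mul_div_cancel_right₀ _ hl', mul_div_cancel₀ _ hl']
  · rw [HKDensity.finrank_fractionRing_tensorProduct]
  · have h1 : l = 1 := by
      rw [h] at hlm
      exact Nat.eq_of_mul_eq_mul_right hn₀pos (hlm.trans (one_mul _).symm)
    simp [h1]
end
end
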